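/- arXiv:1503.02606 — 14 statements merged into one kernel-verified Lean document; each statement's English description precedes it below -/
import Mathlib

section
/- Let P be a monomial linear operator on k[x] given by P(x^n) = β(n)·x^{θ(n)} for all n ∈ ℕ. Then P is a Rota-Baxter operator of weight 0 on k[x] if and only if the following two conditions hold: (1) Z_β + θ(S_β) ⊆ Z_β and S_β + θ(S_β) ⊆ S_β; (2) for all m, n ∈ S_β one has θ(m) + θ(n) = θ(θ(m) + n) = θ(m + θ(n)) and β(m)·β(n) = β(m)·β(θ(m) + n) + β(n)·β(m + θ(n)). -/
open Polynomial

namespace MonomialRotaBaxter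

/-- A weight-zero Rota-Baxter identity on polynomials need only be checked on powers of `X`. -/
lemma rotaBaxter_iff_forall_X_pow {R : Type*} [CommRing R]
    (P : Polynomial R →ₗ[R] Polynomial R) :
    (∀ f g : Polynomial R, P f * P g = P (f * P g) + P (P f * g)) ↔
      ∀ m n : ℕ, P (X ^ m) * P (X ^ n) =
        P (X ^ m * P (X ^ n)) + P (P (X ^ m) * X ^ n) := by
  refine ⟨fun h m n => h _ _, fun h f g => ?_⟩
  induction f using Polynomial.induction_on' with
  | add p q hp hq => simp only [map_add, add_mul, hp, hq]; abel
  | monomial m a =>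
    induction g using Polynomial.induction_on' with
    | add p q hp hq => simp only [map_add, mul_add, hp, hq]; abel
    | monomial n b =>
      simp only [← smul_X_eq_monomial, map_smul, smul_mul_assoc, mul_smul_comm, h m n, smul_add]

/-- On powers of `X`, the Rota-Baxter identity for a monomial operator is an identity between
monomials. -/
lemma X_pow_identity_iff {R : Type*} [CommRing R] {β : ℕ → R} {θ : ℕ → ℕ}
    {P : Polynomial R →ₗ[R] Polynomial R}
    (hP : ∀ n : ℕ, P (X ^ n) = C (β n) * X ^ (θ n)) (m n : ℕ) :
    P (X ^ m) * P (X ^ n) = P (X ^ m * P (X ^ n)) + P (P (X ^ m) * X ^ n) ↔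
      monomial (θ m + θ n) (β m * β n) =
        monomial (θ (m + θ n)) (β n * β (m + θ n)) +
          monomial (θ (θ m + n)) (β m * β (θ m + n)) := by
  have h₁ : X ^ m * (C (β n) * X ^ θ n) = β n • (X ^ (m + θ n) : R[X]) := by
    rw [smul_eq_C_mul, pow_add]; ring
  have h₂ : C (β m) * X ^ θ m * X ^ n = β m • (X ^ (θ m + n) : R[X]) := by
    rw [smul_eq_C_mul, pow_add]; ring
  rw [hP m, hP n, h₁, h₂, map_smul, map_smul, hP, hP]
  simp only [C_mul_X_pow_eq_monomial, smul_monomial, monomial_mul_monomial, smul_eq_mul]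

/-- If a nonzero monomial is a sum of two nonzero monomials, all exponents agree. -/
lemma exponents_eq_of_monomial_eq_add {R : Type*} [Semiring R] {a b c : ℕ} {r s t : R}
    (hr : r ≠ 0) (hs : s ≠ 0) (ht : t ≠ 0)
    (h : monomial a r = monomial b s + monomial c t) : a = b ∧ a = c := by
  have ha := congrArg (coeff · a) h
  have hb := congrArg (coeff · b) h
  have hc := congrArg (coeff · c) h
  simp only [coeff_add, coeff_monomial] at ha hb hc
  grind

/-- The Rota-Baxter identity of weight zero on all pairs of powers of `X`, for the operator
`X ^ n ↦ β n • X ^ θ n`. -/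
def MonomialIdentity {R : Type*} [CommRing R] (β : ℕ → R) (θ : ℕ → ℕ) : Prop :=
  ∀ m n : ℕ, monomial (θ m + θ n) (β m * β n) =
    monomial (θ (m + θ n)) (β n * β (m + θ n)) + monomial (θ (θ m + n)) (β m * β (θ m + n))

/-- The total coefficients of the two sides of the monomial identity agree. -/
lemma coefficient_identity {R : Type*} [CommRing R] {β : ℕ → R} {θ : ℕ → ℕ}
    (h : MonomialIdentity β θ) (m n : ℕ) : β m * β n = β n * β (m + θ n) + β m * β (θ m + n) := by
  simpa using congrArg (eval 1) (h m n)

/-- `Z_β + θ(S_β) ⊆ Z_β`. -/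
lemma zero_add_image {R : Type*} [CommRing R] [IsDomain R] {β : ℕ → R} {θ : ℕ → ℕ}
    (h : MonomialIdentity β θ) {m n : ℕ} (hm : β m = 0) (hn : β n ≠ 0) : β (m + θ n) = 0 := by
  simpa [hm, hn] using coefficient_identity h m n

/-- The zero set of `β` is closed under adding multiples of `θ n` for `n` in the support. -/
lemma zero_add_mul_image {R : Type*} [CommRing R] [IsDomain R] {β : ℕ → R} {θ : ℕ → ℕ}
    (h : MonomialIdentity β θ) {m n : ℕ} (hm : β m = 0) (hn : β n ≠ 0) (k : ℕ) :
    β (m + k * θ n) = 0 := by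
  induction k with
  | zero => simpa using hm
  | succ k ih => simpa [Nat.succ_mul, add_assoc] using zero_add_image h ih hn

/-- Along the progression `m + k * θ m` starting in the support, `β` decays harmonically and
`θ` grows linearly. -/
lemma orbit {R : Type*} [CommRing R] [IsDomain R] [CharZero R] {β : ℕ → R} {θ : ℕ → ℕ}
    (h : MonomialIdentity β θ) {m : ℕ} (hm : β m ≠ 0) (k : ℕ) :
    ((k : R) + 1) * β (m + k * θ m) = β m ∧ θ (m + k * θ m) = (k + 1) * θ m := by
  induction k with
  | zero => simp
  | succ k ih =>
    obtain ⟨ihβ, ihθ⟩ := ih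
    set n := m + k * θ m with hn
    have e₁ : m + θ n = m + (k + 1) * θ m := by rw [ihθ]
    have e₂ : θ m + n = m + (k + 1) * θ m := by rw [hn]; ring
    have hβn : β n ≠ 0 := fun h0 => hm (by rw [← ihβ, h0, mul_zero])
    have hmono := h m n
    have hcoef := coefficient_identity h m n
    rw [e₁, e₂] at hmono hcoef
    rw [← map_add, ← hcoef] at hmono
    have hexp : θ m + θ n = θ (m + (k + 1) * θ m) :=
      ((Polynomial.monomial_eq_monomial_iff).1 hmono).resolve_right
        (fun h0 => mul_ne_zero hm hβn h0.1) |>.1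
    refine ⟨?_, by rw [← hexp, ihθ]; ring⟩
    apply mul_left_cancel₀ hβn
    push_cast
    linear_combination -hcoef + β (m + (k + 1) * θ m) * ihβ

/-- `θ` is positive on the support of `β`. -/
lemma image_pos {R : Type*} [CommRing R] [IsDomain R] {β : ℕ → R} {θ : ℕ → ℕ}
    (h : MonomialIdentity β θ) {m : ℕ} (hm : β m ≠ 0) : 0 < θ m := by
  refine Nat.pos_of_ne_zero fun h0 => hm ?_
  simpa [h0] using coefficient_identity h m m

/-- `S_β + θ(S_β) ⊆ S_β`: otherwise the progression `m + θ n + k * θ n` stays in the zero set but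
meets `m + k * θ m`, which stays in the support. -/
lemma support_add_image {R : Type*} [CommRing R] [IsDomain R] [CharZero R]
    {β : ℕ → R} {θ : ℕ → ℕ}
    (h : MonomialIdentity β θ) {m n : ℕ} (hm : β m ≠ 0) (hn : β n ≠ 0) : β (m + θ n) ≠ 0 := by
  intro h0
  obtain ⟨k, hk⟩ := Nat.exists_eq_succ_of_ne_zero (image_pos h hm).ne'
  have hz := zero_add_mul_image h h0 hn k
  have hmeet : m + θ n + k * θ n = m + θ n * θ m := by
    rw [hk, Nat.succ_eq_add_one]; ring
  have ho := (orbit h hm (θ n)).1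
  rw [← hmeet, hz, mul_zero] at ho
  exact hm ho.symm

end MonomialRotaBaxter

/-- Theorem 2.3 (equivalent condition for a monomial linear operator on `R[x]`
to be a Rota-Baxter operator of weight zero). -/
theorem monomial_rota_baxter_weight_zero_iff
    {R : Type*} [CommRing R] [IsDomain R] [Algebra ℚ R]
    (β : ℕ → R) (θ : ℕ → ℕ) (hconv : ∀ n, β n = 0 → θ n = 0)
    (P : Polynomial R →ₗ[R] Polynomial R)
    (hP : ∀ n : ℕ, P (X ^ n) = C (β n) * X ^ (θ n)) :
    (∀ f g : Polynomial R, P f * P g = P (f * P g) + P (P f * g)) ↔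
      ((∀ m n : ℕ, β m = 0 → β n ≠ 0 → β (m + θ n) = 0) ∧
       (∀ m n : ℕ, β m ≠ 0 → β n ≠ 0 → β (m + θ n) ≠ 0) ∧
       (∀ m n : ℕ, β m ≠ 0 → β n ≠ 0 →
         θ m + θ n = θ (θ m + n) ∧ θ m + θ n = θ (m + θ n)) ∧
       (∀ m n : ℕ, β m ≠ 0 → β n ≠ 0 →
         β m * β n = β m * β (θ m + n) + β n * β (m + θ n))) := by
  have : CharZero R := algebraRat.charZero R
  rw [MonomialRotaBaxter.rotaBaxter_iff_forall_X_pow]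
  simp only [MonomialRotaBaxter.X_pow_identity_iff hP]
  constructor
  · intro h
    refine ⟨fun m n => MonomialRotaBaxter.zero_add_image h,
      fun m n => MonomialRotaBaxter.support_add_image h, fun m n hm hn => ?_, fun m n _ _ => ?_⟩
    · have h₁ := MonomialRotaBaxter.support_add_image h hm hn
      have h₂ := MonomialRotaBaxter.support_add_image h hn hm
      rw [add_comm] at h₂
      exact (MonomialRotaBaxter.exponents_eq_of_monomial_eq_add (mul_ne_zero hm hn)
        (mul_ne_zero hn h₁) (mul_ne_zero hm h₂) (h m n)).symm
    · rw [MonomialRotaBaxter.coefficient_identity h m n, add_comm]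
  · rintro ⟨hZ, -, hθ, hβ⟩ m n
    by_cases hm : β m = 0 <;> by_cases hn : β n = 0
    · simp [hm, hn]
    · simp [hm, hZ m n hm hn]
    · simp [hn, add_comm (θ m) n, hZ n m hn hm]
    · rw [← (hθ m n hm hn).1, ← (hθ m n hm hn).2, ← map_add, hβ m n hm hn, add_comm (β m * _)]
end

section
/- Let P be a monomial Rota-Baxter operator of weight 0 on k[x] given by P(x^n) = β(n)·x^{θ(n)}. Then for every m ∈ ℕ with β(m) ≠ 0 and every k ∈ ℕ, one has β(m + k·θ(m)) ≠ 0, θ(m + k·θ(m)) = (k+1)·θ(m), and β(m + k·θ(m)) = (1/(k+1))·β(m). -/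
open Polynomial

/-- The Rota-Baxter identity of weight zero for a monomial operator, evaluated at two monomials. -/
lemma monomial_rota_baxter_weight_zero_monomial_identity {R : Type*} [CommRing R]
    (β : ℕ → R) (θ : ℕ → ℕ) (P : Polynomial R →ₗ[R] Polynomial R)
    (hP : ∀ n : ℕ, P (X ^ n) = C (β n) * X ^ (θ n))
    (hRB : ∀ f g : Polynomial R, P f * P g = P (f * P g) + P (P f * g)) (m n : ℕ) :
    C (β m * β n) * X ^ (θ m + θ n) =
      C (β n * β (m + θ n)) * X ^ θ (m + θ n) + C (β m * β (n + θ m)) * X ^ θ (n + θ m) := by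
  have h := hRB (X ^ m) (X ^ n)
  have h₁ : (X ^ m * (C (β n) * X ^ θ n) : R[X]) = β n • X ^ (m + θ n) := by
    rw [smul_eq_C_mul]; ring
  have h₂ : (C (β m) * X ^ θ m * X ^ n : R[X]) = β m • X ^ (n + θ m) := by
    rw [smul_eq_C_mul]; ring
  rw [hP, hP, h₁, h₂, map_smul, map_smul, hP, hP, smul_eq_C_mul, smul_eq_C_mul] at h
  simp only [C_mul]
  linear_combination h

/-- Division-free form of the formulas for `θ (m + k * θ m)` and `β (m + k * θ m)`. -/
lemma monomial_rota_baxter_weight_zero_theta_and_succ_mul_beta {R : Type*} [CommRing R] [IsDomain R]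
    (β : ℕ → R) (θ : ℕ → ℕ) (P : Polynomial R →ₗ[R] Polynomial R)
    (hP : ∀ n : ℕ, P (X ^ n) = C (β n) * X ^ (θ n))
    (hRB : ∀ f g : Polynomial R, P f * P g = P (f * P g) + P (P f * g))
    (m : ℕ) (hm : β m ≠ 0) (k : ℕ) :
    θ (m + k * θ m) = (k + 1) * θ m ∧ ((k : R) + 1) * β (m + k * θ m) = β m := by
  induction k with
  | zero => simp
  | succ k ih =>
    obtain ⟨hθ, hβ⟩ := ih
    have h := monomial_rota_baxter_weight_zero_monomial_identity β θ P hP hRB m (m + k * θ m)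
    have hn : β (m + k * θ m) ≠ 0 := fun h₀ => hm (by rw [← hβ, h₀, mul_zero])
    rw [hθ, show m + k * θ m + θ m = m + (k + 1) * θ m by ring,
      show θ m + (k + 1) * θ m = (k + 1 + 1) * θ m by ring] at h
    generalize m + (k + 1) * θ m = n' at h ⊢
    have hc := congrArg (fun p : R[X] => p.coeff ((k + 1 + 1) * θ m)) h
    simp only [coeff_add, coeff_C_mul, coeff_X_pow, if_true] at hc
    by_cases he : (k + 1 + 1) * θ m = θ n'
    · refine ⟨he.symm, mul_left_cancel₀ hn ?_⟩
      simp only [he, if_true] at hc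
      push_cast
      linear_combination β n' * hβ - hc
    · simp [he, hm, hn] at hc

/-- Lemma 2.4: for a monomial Rota-Baxter operator of weight zero, if `β m ≠ 0`
then for every `k`, `β (m + k·θ m) ≠ 0`, `θ (m + k·θ m) = (k+1)·θ m` and
`β (m + k·θ m) = (1/(k+1))·β m`. -/
theorem monomial_rota_baxter_weight_zero_beta_theta_add_mul
    {R : Type*} [CommRing R] [IsDomain R] [Algebra ℚ R]
    (β : ℕ → R) (θ : ℕ → ℕ) (hconv : ∀ n, β n = 0 → θ n = 0)
    (P : Polynomial R →ₗ[R] Polynomial R)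
    (hP : ∀ n : ℕ, P (X ^ n) = C (β n) * X ^ (θ n))
    (hRB : ∀ f g : Polynomial R, P f * P g = P (f * P g) + P (P f * g))
    (m : ℕ) (hm : β m ≠ 0) (k : ℕ) :
    β (m + k * θ m) ≠ 0 ∧
    θ (m + k * θ m) = (k + 1) * θ m ∧
    β (m + k * θ m) = (((k : ℚ) + 1)⁻¹) • β m := by
  have : CharZero R := algebraRat.charZero R
  obtain ⟨hθ, hβ⟩ :=
    monomial_rota_baxter_weight_zero_theta_and_succ_mul_beta β θ P hP hRB m hm k
  refine ⟨fun h₀ => hm (by rw [← hβ, h₀, mul_zero]), hθ, ?_⟩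
  have hk : (k : ℚ) + 1 ≠ 0 := by positivity
  rw [eq_inv_smul_iff₀ hk, Algebra.smul_def, ← hβ]
  simp
end

section
/- Let P be a monomial Rota-Baxter operator of weight 0 on k[x] given by P(x^n) = β(n)·x^{θ(n)}. Then S_β + θ(S_β) ⊆ S_β; that is, for all m, n ∈ ℕ with β(m) ≠ 0 and β(n) ≠ 0, one has β(m + θ(n)) ≠ 0. -/
open Polynomial

/-- A nonzero monomial determines its exponent and its coefficient. -/
lemma eq_and_eq_of_monomial_eq_monomial {R : Type*} [Semiring R] {i j : ℕ} {c d : R}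
    (hc : c ≠ 0) (h : monomial i c = monomial j d) : i = j ∧ c = d := by
  have hi := congrArg (fun p => coeff p i) h
  simp only [coeff_monomial, if_true] at hi
  split_ifs at hi with hij
  · exact ⟨hij.symm, hi⟩
  · exact absurd hi hc

/-- The weight-zero Rota-Baxter identity for a monomial operator, evaluated at two monomials. -/
lemma rotaBaxter_monomial_identity {R : Type*} [CommRing R]
    {β : ℕ → R} {θ : ℕ → ℕ} {P : Polynomial R →ₗ[R] Polynomial R}
    (hP : ∀ n : ℕ, P (X ^ n) = C (β n) * X ^ (θ n))
    (hRB : ∀ f g : Polynomial R, P f * P g = P (f * P g) + P (P f * g)) (u v : ℕ) :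
    monomial (θ u + θ v) (β u * β v) =
      monomial (θ (u + θ v)) (β v * β (u + θ v)) +
        monomial (θ (v + θ u)) (β u * β (v + θ u)) := by
  have hPC : ∀ (c : R) (n : ℕ), P (C c * X ^ n) = C c * (C (β n) * X ^ (θ n)) := by
    intro c n
    rw [← smul_eq_C_mul, map_smul, hP, smul_eq_C_mul]
  have h := hRB (X ^ u) (X ^ v)
  have e₁ : (X ^ u * (C (β v) * X ^ θ v) : R[X]) = C (β v) * X ^ (u + θ v) := by ring
  have e₂ : (C (β u) * X ^ θ u * X ^ v : R[X]) = C (β u) * X ^ (v + θ u) := by ring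
  rw [hP, hP, e₁, e₂, hPC, hPC] at h
  simp only [← C_mul_X_pow_eq_monomial, C_mul]
  linear_combination h

/-- Lemma 2.5: for a monomial Rota-Baxter operator of weight zero,
`S_β + θ(S_β) ⊆ S_β`. -/
theorem monomial_rota_baxter_weight_zero_support_add_theta_support
    {R : Type*} [CommRing R] [IsDomain R] [Algebra ℚ R]
    (β : ℕ → R) (θ : ℕ → ℕ) (hconv : ∀ n, β n = 0 → θ n = 0)
    (P : Polynomial R →ₗ[R] Polynomial R)
    (hP : ∀ n : ℕ, P (X ^ n) = C (β n) * X ^ (θ n))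
    (hRB : ∀ f g : Polynomial R, P f * P g = P (f * P g) + P (P f * g)) :
    ∀ m n : ℕ, β m ≠ 0 → β n ≠ 0 → β (m + θ n) ≠ 0 := by
  intro m n hm hn h0
  have : CharZero R := algebraRat.charZero R
  have key := rotaBaxter_monomial_identity hP hRB
  have hcoincide : ∀ u v, β u ≠ 0 → β v ≠ 0 → v + θ u = u + θ v →
      θ u + θ v = θ (u + θ v) ∧ β u * β v = β v * β (u + θ v) + β u * β (u + θ v) := by
    intro u v hu hv huv
    have h := key u v
    rw [huv, ← map_add] at h
    exact eq_and_eq_of_monomial_eq_monomial (mul_ne_zero hu hv) h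
  have hright : ∀ u v, β u ≠ 0 → β v ≠ 0 → β (u + θ v) = 0 →
      β (v + θ u) = β v ∧ θ (v + θ u) = θ u + θ v := by
    intro u v hu hv huv
    have h := key u v
    rw [huv, mul_zero, map_zero, zero_add] at h
    obtain ⟨h₁, h₂⟩ := eq_and_eq_of_monomial_eq_monomial (mul_ne_zero hu hv) h
    exact ⟨(mul_left_cancel₀ hu h₂).symm, h₁.symm⟩
  have hzero : ∀ u v, β u = 0 → β v ≠ 0 → β (u + θ v) = 0 := by
    intro u v hu hv
    have h := key u v
    rw [hu, zero_mul, zero_mul, map_zero, map_zero, add_zero, eq_comm,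
      monomial_eq_zero_iff] at h
    exact (mul_eq_zero.mp h).resolve_left hv
  have hout : ∀ k : ℕ, β (m + (θ n + k * θ m)) = 0 := by
    intro k
    induction k with
    | zero => simpa using h0
    | succ k ih =>
      have h := hzero _ m ih hm
      rwa [show m + (θ n + k * θ m) + θ m = m + (θ n + (k + 1) * θ m) by ring] at h
  have hconst : ∀ k : ℕ, β (n + k * θ m) = β n ∧ θ (n + k * θ m) = θ n + k * θ m := by
    intro k
    induction k with
    | zero => simp
    | succ k ih =>
      obtain ⟨ih₁, ih₂⟩ := ih
      have h := hright m (n + k * θ m) hm (ih₁ ▸ hn) (by rw [ih₂]; exact hout k)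
      rw [show n + k * θ m + θ m = n + (k + 1) * θ m by ring, ih₁, ih₂] at h
      exact ⟨h.1, h.2.trans (by ring)⟩
  have hharmonic : ∀ k : ℕ, ((k : R) + 1) * β (n + k * θ n) = β n ∧
      θ (n + k * θ n) = (k + 1) * θ n := by
    intro k
    induction k with
    | zero => simp
    | succ k ih =>
      obtain ⟨ih₁, ih₂⟩ := ih
      have hk : β (n + k * θ n) ≠ 0 := fun h => hn (by rw [← ih₁, h, mul_zero])
      have h := hcoincide n (n + k * θ n) hn hk (by rw [ih₂]; ring)
      rw [ih₂] at h
      refine ⟨mul_left_cancel₀ hk ?_, h.1.symm.trans (by ring)⟩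
      push_cast
      linear_combination (-1 : R) * h.2 + β (n + (k + 1) * θ n) * ih₁
  have hθm : θ m ≠ 0 := by
    intro h
    have h₂ := (hcoincide m m hm hm rfl).2
    rw [h, add_zero] at h₂
    exact mul_ne_zero hm hm (by linear_combination -h₂)
  have h₁ := (hharmonic (θ m)).1
  rw [mul_comm (θ m), (hconst (θ n)).1] at h₁
  have h₂ : (θ m : R) * β n = 0 := by linear_combination h₁
  exact mul_ne_zero (Nat.cast_ne_zero.mpr hθm) hn h₂
end

section
/- Let P be a nonzero monomial Rota-Baxter operator of weight 0 on k[x] given by P(x^n) = β(n)·x^{θ(n)}, let d = gcd(θ(S_β)), and for n ∈ ℕ let n̄ ∈ {0, 1, …, d−1} denote the remainder of n modulo d. Then: (1) β(n) ≠ 0 if and only if β(n̄) ≠ 0; and (2) for every n with β(n) ≠ 0, one has θ(n) = θ(n̄) + n − n̄. -/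
open Polynomial

/-- The coefficientwise form, on monomials, of the Rota-Baxter identity of weight zero for the
operator `x ^ n ↦ β n * x ^ θ n`. -/
def MonomialRotaBaxterIdentity {R : Type*} [CommRing R] (β : ℕ → R) (θ : ℕ → ℕ) : Prop :=
  ∀ m n i : ℕ, (if i = θ m + θ n then β m * β n else 0) =
    (if i = θ (m + θ n) then β n * β (m + θ n) else 0) +
      (if i = θ (n + θ m) then β m * β (n + θ m) else 0)

/-- `t` is a period of the support of `β`, and `θ` is equivariant under translation by `t`. -/
def IsMonomialPeriod {R : Type*} [CommRing R] (β : ℕ → R) (θ : ℕ → ℕ) (t : ℕ) : Prop :=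
  ∀ n : ℕ, (β (n + t) ≠ 0 ↔ β n ≠ 0) ∧ (β n ≠ 0 → θ (n + t) = θ n + t)

namespace IsMonomialPeriod

variable {R : Type*} [CommRing R] {β : ℕ → R} {θ : ℕ → ℕ} {s t : ℕ}

theorem zero : IsMonomialPeriod β θ 0 := fun _ => ⟨Iff.rfl, fun _ => rfl⟩

theorem add (hs : IsMonomialPeriod β θ s) (ht : IsMonomialPeriod β θ t) :
    IsMonomialPeriod β θ (s + t) := by
  intro n
  rw [← add_assoc]
  refine ⟨(ht (n + s)).1.trans (hs n).1, fun hn => ?_⟩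
  rw [(ht (n + s)).2 ((hs n).1.2 hn), (hs n).2 hn, add_assoc]

theorem of_add (hs : IsMonomialPeriod β θ s) (hst : IsMonomialPeriod β θ (t + s)) :
    IsMonomialPeriod β θ t := by
  intro n
  have hsupp : β (n + t) ≠ 0 ↔ β n ≠ 0 := by
    rw [← (hs (n + t)).1, add_assoc, (hst n).1]
  refine ⟨hsupp, fun hn => ?_⟩
  have h₁ := (hs (n + t)).2 (hsupp.2 hn)
  have h₂ := (hst n).2 hn
  rw [← add_assoc] at h₂
  omega

theorem mul_right (ht : IsMonomialPeriod β θ t) (q : ℕ) : IsMonomialPeriod β θ (t * q) := by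
  induction q with
  | zero => exact zero
  | succ q ih => exact ih.add ht

theorem mod (hs : IsMonomialPeriod β θ s) (ht : IsMonomialPeriod β θ t) :
    IsMonomialPeriod β θ (t % s) :=
  (hs.mul_right (t / s)).of_add (by rwa [Nat.mod_add_div])

/-- If some member of a family of periods is positive, then every number divisible by all common
divisors of the family is a period. -/
theorem of_forall_dvd {p : ℕ → Prop} (hper : ∀ u, p u → IsMonomialPeriod β θ u)
    (hpos : ∃ u, 0 < u ∧ p u) {d : ℕ} (hd : ∀ e, (∀ u, p u → e ∣ u) → e ∣ d) :
    IsMonomialPeriod β θ d := by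
  classical
  have hex : ∃ u, 0 < u ∧ IsMonomialPeriod β θ u :=
    hpos.imp fun u hu => ⟨hu.1, hper u hu.2⟩
  obtain ⟨hepos, heper⟩ := Nat.find_spec hex
  obtain ⟨q, rfl⟩ := hd (Nat.find hex) fun u hu => by
    by_contra hdvd
    exact Nat.find_min hex (Nat.mod_lt u hepos)
      ⟨Nat.pos_of_ne_zero fun h => hdvd (Nat.dvd_of_mod_eq_zero h), heper.mod (hper u hu)⟩
  exact heper.mul_right q

end IsMonomialPeriod

namespace MonomialRotaBaxterIdentity

variable {R : Type*} [CommRing R] [IsDomain R] {β : ℕ → R} {θ : ℕ → ℕ} {m n : ℕ}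

theorem theta_add (h : MonomialRotaBaxterIdentity β θ) (hm : β m ≠ 0) (hn : β n ≠ 0)
    (hmn : β (m + θ n) ≠ 0) : θ (m + θ n) = θ m + θ n := by
  by_contra hne
  have h₁ := h m n (θ (m + θ n))
  rw [if_neg hne, if_pos rfl] at h₁
  split_ifs at h₁ with heq
  · have h₂ := h m n (θ m + θ n)
    rw [if_pos rfl, if_neg (Ne.symm hne), if_neg (heq ▸ Ne.symm hne), add_zero] at h₂
    exact mul_ne_zero hm hn h₂
  · rw [add_zero] at h₁
    exact mul_ne_zero hn hmn h₁.symm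

theorem theta_pos (h : MonomialRotaBaxterIdentity β θ) (hm : β m ≠ 0) : 0 < θ m := by
  by_contra hpos
  have hzero : θ m = 0 := by omega
  have h₁ := h m m 0
  simp only [hzero, add_zero, if_true] at h₁
  exact mul_ne_zero hm hm (by linear_combination -h₁)

theorem add_theta_eq_zero (h : MonomialRotaBaxterIdentity β θ) (hzero : ∀ n, β n = 0 → θ n = 0)
    (hm : β m = 0) (hn : β n ≠ 0) : β (m + θ n) = 0 := by
  have h₁ := h m n (θ (m + θ n))
  simpa [hm, hzero m hm, hn] using h₁

theorem add_theta_mul_eq_zero (h : MonomialRotaBaxterIdentity β θ)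
    (hzero : ∀ n, β n = 0 → θ n = 0) (hm : β m = 0) (hn : β n ≠ 0) (q : ℕ) :
    β (m + θ n * q) = 0 := by
  induction q with
  | zero => exact hm
  | succ q ih =>
    rw [Nat.mul_succ, ← add_assoc]
    exact h.add_theta_eq_zero hzero ih hn

theorem iterate_theta (h : MonomialRotaBaxterIdentity β θ) (hm : β m ≠ 0) (q : ℕ) :
    β (m + θ m * q) ≠ 0 ∧ θ (m + θ m * q) = θ m * (q + 1) := by
  induction q with
  | zero => simpa using hm
  | succ q ih =>
    obtain ⟨hβ, hθ⟩ := ih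
    have hstep : m + θ m * (q + 1) = m + θ m * q + θ m := by ring
    have hne : β (m + θ m * q + θ m) ≠ 0 := by
      intro hz
      have h₁ := h m (m + θ m * q) (θ m + θ (m + θ m * q))
      rw [hθ, hstep, hz] at h₁
      simp only [mul_zero, ite_self, add_zero, if_true] at h₁
      exact mul_ne_zero hm hβ h₁
    rw [hstep]
    refine ⟨hne, ?_⟩
    rw [h.theta_add hβ hm hne, hθ]
    ring

theorem add_theta_ne_zero (h : MonomialRotaBaxterIdentity β θ) (hzero : ∀ n, β n = 0 → θ n = 0)
    (hm : β m ≠ 0) (hn : β n ≠ 0) : β (m + θ n) ≠ 0 := by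
  intro hz
  apply (h.iterate_theta hm (θ n)).1
  have h₁ := h.add_theta_mul_eq_zero hzero hz hn (θ m - 1)
  obtain ⟨a, ha⟩ := Nat.exists_eq_add_of_lt (h.theta_pos hm)
  rw [ha] at h₁ ⊢
  convert h₁ using 2
  simp only [zero_add, Nat.add_sub_cancel]
  ring

theorem isMonomialPeriod_theta (h : MonomialRotaBaxterIdentity β θ)
    (hzero : ∀ n, β n = 0 → θ n = 0) (hn : β n ≠ 0) : IsMonomialPeriod β θ (θ n) := fun _ =>
  ⟨⟨fun hmn hm => hmn (h.add_theta_eq_zero hzero hm hn),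
    fun hm => h.add_theta_ne_zero hzero hm hn⟩,
    fun hm => h.theta_add hm hn (h.add_theta_ne_zero hzero hm hn)⟩

end MonomialRotaBaxterIdentity

theorem monomialRotaBaxterIdentity_of_linearMap {R : Type*} [CommRing R] {β : ℕ → R}
    {θ : ℕ → ℕ} {P : Polynomial R →ₗ[R] Polynomial R}
    (hP : ∀ n : ℕ, P (X ^ n) = C (β n) * X ^ (θ n))
    (hRB : ∀ f g : Polynomial R, P f * P g = P (f * P g) + P (P f * g)) :
    MonomialRotaBaxterIdentity β θ := by
  intro m n i
  have hmul : ∀ (a : R) (j : ℕ), P (C a * X ^ j) = C (a * β j) * X ^ θ j := by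
    intro a j
    rw [← smul_eq_C_mul, map_smul, hP, smul_eq_C_mul, C_mul, mul_assoc]
  have key : C (β m * β n) * X ^ (θ m + θ n) =
      C (β n * β (m + θ n)) * X ^ θ (m + θ n) + C (β m * β (n + θ m)) * X ^ θ (n + θ m) := by
    have h₁ := hRB (X ^ m) (X ^ n)
    have h₂ : (X : Polynomial R) ^ m * (C (β n) * X ^ θ n) = C (β n) * X ^ (m + θ n) := by ring
    have h₃ : C (β m) * (X : Polynomial R) ^ θ m * X ^ n = C (β m) * X ^ (n + θ m) := by ring
    rw [hP, hP, h₂, h₃, hmul, hmul] at h₁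
    rw [← h₁, C_mul]
    ring
  simpa only [coeff_add, coeff_C_mul_X_pow] using congrArg (fun p => p.coeff i) key

/-- Lemma 2.7: for a nonzero monomial Rota-Baxter operator of weight zero,
with `d = gcd(θ(S_β))` and `n̄ = n % d`, one has `β n ≠ 0 ↔ β n̄ ≠ 0`, and
`θ n = θ n̄ + n − n̄` for every `n` with `β n ≠ 0`. -/
theorem monomial_rota_baxter_weight_zero_theta_values
    {R : Type*} [CommRing R] [IsDomain R] [Algebra ℚ R]
    (β : ℕ → R) (θ : ℕ → ℕ) (hconv : ∀ n, β n = 0 → θ n = 0)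
    (P : Polynomial R →ₗ[R] Polynomial R)
    (hP : ∀ n : ℕ, P (X ^ n) = C (β n) * X ^ (θ n))
    (hRB : ∀ f g : Polynomial R, P f * P g = P (f * P g) + P (P f * g))
    (hne : ∃ n : ℕ, β n ≠ 0)
    (d : ℕ)
    (hd_dvd : ∀ n : ℕ, β n ≠ 0 → d ∣ θ n)
    (hd_gcd : ∀ e : ℕ, (∀ n : ℕ, β n ≠ 0 → e ∣ θ n) → e ∣ d) :
    (∀ n : ℕ, β n ≠ 0 ↔ β (n % d) ≠ 0) ∧
    (∀ n : ℕ, β n ≠ 0 → θ n = θ (n % d) + (n - n % d)) := by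
  have h := monomialRotaBaxterIdentity_of_linearMap hP hRB
  have hper : IsMonomialPeriod β θ d := by
    refine IsMonomialPeriod.of_forall_dvd (p := fun u => ∃ n, β n ≠ 0 ∧ θ n = u) ?_ ?_ ?_
    · rintro _ ⟨n, hn, rfl⟩
      exact h.isMonomialPeriod_theta hconv hn
    · obtain ⟨n, hn⟩ := hne
      exact ⟨θ n, h.theta_pos hn, n, hn, rfl⟩
    · exact fun e he => hd_gcd e fun n hn => he _ ⟨n, hn, rfl⟩
  have hshift (n : ℕ) : (β n ≠ 0 ↔ β (n % d) ≠ 0) ∧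
      (β (n % d) ≠ 0 → θ n = θ (n % d) + d * (n / d)) := by
    simpa only [Nat.mod_add_div] using hper.mul_right (n / d) (n % d)
  refine ⟨fun n => (hshift n).1, fun n hn => ?_⟩
  rw [(hshift n).2 ((hshift n).1.1 hn)]
  have := Nat.mod_add_div n d
  omega
end

section
/- Let P be a nonzero monomial Rota-Baxter operator of weight 0 on k[x] given by P(x^n) = β(n)·x^{θ(n)}, let d = gcd(θ(S_β)), and for n ∈ ℕ with β(n) ≠ 0 let n̄ ∈ {0, 1, …, d−1} be the remainder of n modulo d. Then β(n) = (θ(n̄) / (θ(n̄) + n − n̄))·β(n̄), where the coefficient θ(n̄)/(θ(n̄) + n − n̄) is a rational number acting on k via the inclusion ℚ ⊆ k. -/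
open Polynomial

/-- The weight zero Rota-Baxter identity evaluated on the monomials `X ^ m` and `X ^ n`, for the
operator `X ^ n ↦ β n * X ^ θ n`. -/
def MonomialRotaBaxter {R : Type*} [CommRing R] (β : ℕ → R) (θ : ℕ → ℕ) : Prop :=
  ∀ m n : ℕ, monomial (θ m + θ n) (β m * β n) =
    monomial (θ (m + θ n)) (β n * β (m + θ n)) + monomial (θ (n + θ m)) (β m * β (n + θ m))

theorem monomialRotaBaxter_of_linearMap {R : Type*} [CommRing R] {β : ℕ → R} {θ : ℕ → ℕ}
    (P : Polynomial R →ₗ[R] Polynomial R)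
    (hP : ∀ n : ℕ, P (X ^ n) = C (β n) * X ^ (θ n))
    (hRB : ∀ f g : Polynomial R, P f * P g = P (f * P g) + P (P f * g)) :
    MonomialRotaBaxter β θ := by
  intro m n
  have hX : ∀ (c : R) (a b : ℕ), P (X ^ a * (C c * X ^ b)) = monomial (θ (a + b)) (c * β (a + b)) := by
    intro c a b
    have : (X : R[X]) ^ a * (C c * X ^ b) = c • X ^ (a + b) := by
      rw [smul_eq_C_mul, pow_add]; ring
    rw [this, map_smul, hP, smul_eq_C_mul, ← mul_assoc, ← C_mul, C_mul_X_pow_eq_monomial]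
  have h := hRB (X ^ m) (X ^ n)
  rw [hP, hP, mul_comm (C (β m) * X ^ θ m) (X ^ n), hX, hX] at h
  rw [← h, C_mul_X_pow_eq_monomial, C_mul_X_pow_eq_monomial, monomial_mul_monomial]

namespace MonomialRotaBaxter

variable {R : Type*} [CommRing R] {β : ℕ → R} {θ : ℕ → ℕ}

theorem coeff_eq (h : MonomialRotaBaxter β θ) (m n t : ℕ) :
    (if θ m + θ n = t then β m * β n else 0) =
      (if θ (m + θ n) = t then β n * β (m + θ n) else 0) +
        (if θ (n + θ m) = t then β m * β (n + θ m) else 0) := by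
  simpa [coeff_monomial] using congrArg (fun p => p.coeff t) (h m n)

variable [IsDomain R]

theorem add_eq_zero_of_eq_zero (h : MonomialRotaBaxter β θ) {m n : ℕ} (hm : β m = 0)
    (hn : β n ≠ 0) : β (m + θ n) = 0 := by
  simpa [hm, hn] using h.coeff_eq m n (θ (m + θ n))

theorem theta_add (h : MonomialRotaBaxter β θ) {m n : ℕ} (hm : β m ≠ 0) (hn : β n ≠ 0)
    (hmn : β (m + θ n) ≠ 0) : θ (m + θ n) = θ m + θ n := by
  by_contra hne
  have h₁ := h.coeff_eq m n (θ (m + θ n))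
  have h₂ := h.coeff_eq m n (θ m + θ n)
  have hp : β m * β n ≠ 0 := mul_ne_zero hm hn
  have hq : β n * β (m + θ n) ≠ 0 := mul_ne_zero hn hmn
  rw [if_neg (Ne.symm hne), if_pos rfl] at h₁
  rw [if_pos rfl, if_neg hne] at h₂
  split_ifs at h₁ h₂ with h₃ h₄
  · exact hne (h₃.symm.trans h₄)
  · exact hp (by simpa using h₂)
  · exact hq (by simpa using h₁.symm)
  · exact hq (by simpa using h₁.symm)

theorem add_mem_closure_eq_zero (h : MonomialRotaBaxter β θ) {s : ℕ}
    (hs : s ∈ AddSubmonoid.closure (θ '' {n | β n ≠ 0})) :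
    ∀ m, β m = 0 → β (m + s) = 0 := by
  induction hs using AddSubmonoid.closure_induction with
  | mem x hx =>
    obtain ⟨n, hn, rfl⟩ := hx
    exact fun m hm => h.add_eq_zero_of_eq_zero hm hn
  | zero => simp
  | add x y _ _ hx hy => exact fun m hm => by simpa [add_assoc] using hy _ (hx m hm)

variable [CharZero R]

theorem iterate (h : MonomialRotaBaxter β θ) {n : ℕ} (hn : β n ≠ 0) (k : ℕ) :
    θ (n + k * θ n) = (k + 1) * θ n ∧ ((k + 1 : ℕ) : R) * β (n + k * θ n) = β n := by
  induction k with
  | zero => simp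
  | succ k ih =>
    obtain ⟨hθ, hβ⟩ := ih
    set m := n + k * θ n with hm
    have hk : ((k + 1 : ℕ) : R) ≠ 0 := Nat.cast_ne_zero.mpr k.succ_ne_zero
    have hm0 : β m ≠ 0 := fun h0 => hn (by rw [← hβ, h0, mul_zero])
    have e₁ : m + θ n = n + (k + 1) * θ n := by rw [hm]; ring
    have e₂ : n + θ m = n + (k + 1) * θ n := by rw [hθ]
    have e₃ : θ m + θ n = (k + 1 + 1) * θ n := by rw [hθ]; ring
    have key := h.coeff_eq m n (θ m + θ n)
    rw [if_pos rfl, e₁, e₂] at key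
    split_ifs at key with hc
    · refine ⟨hc.trans e₃, mul_left_cancel₀ hm0 ?_⟩
      rw [← hβ] at key ⊢
      push_cast at key ⊢
      linear_combination -key
    · exact absurd (by simpa using key) (mul_ne_zero hm0 hn)

theorem theta_pos (h : MonomialRotaBaxter β θ) {n : ℕ} (hn : β n ≠ 0) : 0 < θ n := by
  by_contra h0
  have h1 := (h.iterate hn 1).2
  rw [Nat.eq_zero_of_not_pos h0] at h1
  apply hn
  push_cast at h1
  simp only [add_zero] at h1
  linear_combination h1

/-- The support of `β` is a union of residue classes modulo the gcd of the exponents. -/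
theorem ne_zero_of_modEq (h : MonomialRotaBaxter β θ) {m n : ℕ} (hn : β n ≠ 0)
    (hmn : m ≡ n [MOD Nat.setGcd (θ '' {n | β n ≠ 0})]) : β m ≠ 0 := by
  intro hm
  obtain ⟨N, hN⟩ := Nat.exists_mem_closure_of_ge (θ '' {n | β n ≠ 0})
  set k := m + N
  have hle : m + N ≤ n + k * θ n :=
    (Nat.le_mul_of_pos_right k (h.theta_pos hn)).trans (Nat.le_add_left _ n)
  have hdvd : Nat.setGcd (θ '' {n | β n ≠ 0}) ∣ θ n := Nat.setGcd_dvd_of_mem ⟨n, hn, rfl⟩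
  have hmod : m ≡ n + k * θ n [MOD Nat.setGcd (θ '' {n | β n ≠ 0})] :=
    hmn.trans ((Nat.modEq_zero_iff_dvd.mpr (hdvd.mul_left k)).symm.add_left n)
  have h0 := h.add_mem_closure_eq_zero
    (hN (n + k * θ n - m) (by omega) ((Nat.modEq_iff_dvd' (by omega)).mp hmod)) m hm
  rw [Nat.add_sub_cancel' (by omega)] at h0
  exact hn (by rw [← (h.iterate hn k).2, h0, mul_zero])

theorem theta_add_mem_closure (h : MonomialRotaBaxter β θ) {s : ℕ}
    (hs : s ∈ AddSubmonoid.closure (θ '' {n | β n ≠ 0})) :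
    ∀ m, β m ≠ 0 → β (m + s) ≠ 0 ∧ θ (m + s) = θ m + s := by
  have hadd : ∀ {a b : ℕ}, β a ≠ 0 → β b ≠ 0 → β (a + θ b) ≠ 0 := fun {a b} ha hb =>
    h.ne_zero_of_modEq ha
      ((Nat.modEq_zero_iff_dvd.mpr (Nat.setGcd_dvd_of_mem (Set.mem_image_of_mem θ hb))).add_left a)
  induction hs using AddSubmonoid.closure_induction with
  | mem x hx =>
    obtain ⟨n, hn, rfl⟩ := hx
    exact fun m hm => ⟨hadd hm hn, h.theta_add hm hn (hadd hm hn)⟩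
  | zero => simp
  | add x y _ _ hx hy =>
    intro m hm
    obtain ⟨h₁, h₂⟩ := hx m hm
    obtain ⟨h₃, h₄⟩ := hy _ h₁
    rw [← add_assoc]
    exact ⟨h₃, by rw [h₄, h₂, add_assoc]⟩

theorem theta_add_eq_of_modEq (h : MonomialRotaBaxter β θ) {m n : ℕ} (hn : β n ≠ 0)
    (hmn : m ≡ n [MOD Nat.setGcd (θ '' {n | β n ≠ 0})]) (hle : m ≤ n) :
    θ n = θ m + (n - m) := by
  obtain ⟨N, hN⟩ := Nat.exists_mem_closure_of_ge (θ '' {n | β n ≠ 0})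
  set g := Nat.setGcd (θ '' {n | β n ≠ 0})
  have hg : 0 < g := Nat.pos_of_dvd_of_pos (Nat.setGcd_dvd_of_mem ⟨n, hn, rfl⟩) (h.theta_pos hn)
  have hs := hN (g * N) (Nat.le_mul_of_pos_left N hg) (dvd_mul_right g N)
  have ht := hN (n - m + g * N) (by nlinarith [Nat.zero_le (n - m)])
    (((Nat.modEq_iff_dvd' hle).mp hmn).add (dvd_mul_right g N))
  have h₁ := (h.theta_add_mem_closure hs n hn).2
  have h₂ := (h.theta_add_mem_closure ht m (h.ne_zero_of_modEq hn hmn)).2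
  rw [← add_assoc, Nat.add_sub_cancel' hle] at h₂
  omega

/-- Along a residue class of the support, the product `θ n * β n` is constant. -/
theorem theta_mul_eq_of_theta_add_eq (h : MonomialRotaBaxter β θ) {m n : ℕ} (hm : β m ≠ 0)
    (hn : β n ≠ 0) (hmn : θ n + m = θ m + n) : (θ n : R) * β n = θ m * β m := by
  obtain ⟨a, ha⟩ := Nat.exists_eq_succ_of_ne_zero (h.theta_pos hm).ne'
  obtain ⟨b, hb⟩ := Nat.exists_eq_succ_of_ne_zero (h.theta_pos hn).ne'
  have h₁ := (h.iterate hn a).2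
  have h₂ := (h.iterate hm b).2
  have e : n + a * θ n = m + b * θ m := by
    rw [ha, hb] at hmn ⊢
    simp only [Nat.succ_eq_add_one] at hmn ⊢
    nlinarith
  rw [← Nat.succ_eq_add_one, ← ha, e] at h₁
  rw [← Nat.succ_eq_add_one, ← hb] at h₂
  rw [← h₁, ← h₂]
  ring

end MonomialRotaBaxter

/-- Lemma 2.8: for a nonzero monomial Rota-Baxter operator of weight zero,
with `d = gcd(θ(S_β))` and `n̄ = n % d`, for every `n` with `β n ≠ 0` one has
`β n = (θ n̄ / (θ n̄ + n − n̄)) • β n̄`. -/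
theorem monomial_rota_baxter_weight_zero_beta_values
    {R : Type*} [CommRing R] [IsDomain R] [Algebra ℚ R]
    (β : ℕ → R) (θ : ℕ → ℕ) (hconv : ∀ n, β n = 0 → θ n = 0)
    (P : Polynomial R →ₗ[R] Polynomial R)
    (hP : ∀ n : ℕ, P (X ^ n) = C (β n) * X ^ (θ n))
    (hRB : ∀ f g : Polynomial R, P f * P g = P (f * P g) + P (P f * g))
    (hne : ∃ n : ℕ, β n ≠ 0)
    (d : ℕ)
    (hd_dvd : ∀ n : ℕ, β n ≠ 0 → d ∣ θ n)
    (hd_gcd : ∀ e : ℕ, (∀ n : ℕ, β n ≠ 0 → e ∣ θ n) → e ∣ d) :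
    ∀ n : ℕ, β n ≠ 0 →
      β n = (((θ (n % d) : ℚ)) / ((θ (n % d) + (n - n % d) : ℕ) : ℚ)) • β (n % d) := by
  intro n hn
  have : CharZero R := algebraRat.charZero R
  have h := monomialRotaBaxter_of_linearMap P hP hRB
  have hd : Nat.setGcd (θ '' {n | β n ≠ 0}) ∣ d :=
    (hd_gcd _ fun k hk => Nat.setGcd_dvd_of_mem ⟨k, hk, rfl⟩)
  have hmod : n % d ≡ n [MOD Nat.setGcd (θ '' {n | β n ≠ 0})] := (Nat.mod_modEq n d).of_dvd hd
  have hθ := h.theta_add_eq_of_modEq hn hmod (Nat.mod_le n d)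
  have hm := h.ne_zero_of_modEq hn hmod
  have key := h.theta_mul_eq_of_theta_add_eq hm hn (by have := Nat.mod_le n d; omega)
  have hpos : (θ n : ℚ) ≠ 0 := Nat.cast_ne_zero.mpr (h.theta_pos hn).ne'
  rw [← hθ, div_eq_inv_mul, mul_smul, eq_inv_smul_iff₀ hpos, Algebra.smul_def, Algebra.smul_def,
    map_natCast, map_natCast, key]
end

section
/- Let λ ∈ k with λ ≠ 0, and let P be a monomial Rota-Baxter operator of weight λ on k[x] given by P(x^n) = β(n)·x^{θ(n)}. Then θ(0) = 0 and θ(θ(n)) = θ(n) for all n ∈ ℕ. -/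
open Polynomial

/-- Lemma 3.2(1): for a monomial Rota-Baxter operator of nonzero weight `λ`,
`θ 0 = 0` and `θ (θ n) = θ n` for all `n`. -/
theorem monomial_rota_baxter_nonzero_weight_theta_idempotent
    {R : Type*} [CommRing R] [IsDomain R] [Algebra ℚ R]
    (lam : R) (hlam : lam ≠ 0)
    (β : ℕ → R) (θ : ℕ → ℕ) (hconv : ∀ n, β n = 0 → θ n = 0)
    (P : Polynomial R →ₗ[R] Polynomial R)
    (hP : ∀ n : ℕ, P (X ^ n) = C (β n) * X ^ (θ n))
    (hRB : ∀ f g : Polynomial R,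
      P f * P g = P (f * P g) + P (P f * g) + lam • P (f * g)) :
    θ 0 = 0 ∧ ∀ n : ℕ, θ (θ n) = θ n := by
  have hCX : ∀ (a : R) (n : ℕ), P (C a * X ^ n) = C (a * β n) * X ^ θ n := fun a n => by
    rw [← smul_eq_C_mul, map_smul, hP, smul_eq_C_mul, ← mul_assoc, ← C_mul]
  have hβ0 : β 0 ≠ 0 → θ 0 = 0 := by
    intro hb
    by_contra ht
    have h := hRB (X ^ 0) (X ^ 0)
    rw [hP, ← pow_add, add_zero, hP, pow_zero, one_mul, mul_one, hCX] at h
    have h₁ := congrArg (coeff · (θ 0)) h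
    have h₂ := congrArg (coeff · (θ 0 + θ 0)) h
    rw [mul_mul_mul_comm, ← C_mul, ← pow_add] at h₁ h₂
    simp only [coeff_add, coeff_smul, coeff_C_mul_X_pow, smul_eq_mul] at h₁ h₂
    have hne : θ 0 ≠ θ 0 + θ 0 := by omega
    have hne' : θ 0 + θ 0 ≠ θ 0 := by omega
    simp only [hne, hne', if_true, if_false, mul_zero, add_zero] at h₁ h₂
    by_cases hθ : θ 0 + θ 0 = θ (θ 0)
    · rw [← hθ, if_neg hne, add_zero, zero_add] at h₁
      exact mul_ne_zero hlam hb h₁.symm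
    · rw [if_neg hθ, add_zero] at h₂
      exact mul_ne_zero hb hb h₂
  have h0 : θ 0 = 0 := by
    by_cases hb : β 0 = 0
    · exact hconv 0 hb
    · exact hβ0 hb
  refine ⟨h0, fun n => ?_⟩
  by_cases hb : β n = 0
  · rw [hconv n hb, h0]
  have h := hRB (X ^ 0) (X ^ n)
  rw [hP, hP, h0, pow_zero, one_mul, one_mul, mul_one, hCX, hCX, hP, ← mul_assoc, ← C_mul] at h
  have h₁ := congrArg (coeff · (θ n)) h
  simp only [coeff_add, coeff_smul, coeff_C_mul_X_pow, smul_eq_mul, if_true] at h₁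
  by_contra hθ
  rw [if_neg (Ne.symm hθ), zero_add, left_eq_add] at h₁
  exact mul_ne_zero hlam hb h₁
end

section
/- Let λ ∈ k with λ ≠ 0, and let P be a monomial Rota-Baxter operator of weight λ on k[x] given by P(x^n) = β(n)·x^{θ(n)}. Then either β(θ(n)) = −λ for all n ∈ ℕ, or β(θ(n)) = 0 for all n with β(n) = 0 and β(θ(n)) = −λ for all n with β(n) ≠ 0. In particular, β(n) ≠ 0 implies β(θ(n)) ≠ 0 (i.e. θ(S_β) ⊆ S_β), and β(0) equals either 0 or −λ. -/
open Polynomial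

/-- The Rota-Baxter identity on `1 * 1` forces `P 1` to be `0` or `-lam`. -/
theorem monomial_relation_at_zero {R : Type*} [CommRing R] [IsDomain R]
    {lam b c : R} (hlam : lam ≠ 0) {s t : ℕ} (hb : b ≠ 0) (hst : s = 0 → c = b ∧ t = 0)
    (h : (C b * X ^ s * (C b * X ^ s) : R[X]) =
      C b * (C c * X ^ t) + C b * (C c * X ^ t) + lam • (C b * X ^ s)) :
    s = 0 ∧ b = -lam := by
  have hco (i : ℕ) : b * (if i = s + s then b else 0) =
      b * ((if i = t then c else 0) + (if i = t then c else 0) +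
        lam * (if i = s then 1 else 0)) := by
    have h' : (C (b * b) * X ^ (s + s) : R[X]) =
        C (b * c) * X ^ t + C (b * c) * X ^ t + C (lam * b) * X ^ s := by
      simp only [smul_eq_C_mul, C_mul, pow_add] at h ⊢
      linear_combination h
    have := congrArg (fun p => coeff p i) h'
    simp only [coeff_add, coeff_C_mul_X_pow] at this
    split_ifs at this ⊢ <;> linear_combination this
  replace hco (i : ℕ) := mul_left_cancel₀ hb (hco i)
  have h1 := hco s
  have h2 := hco (s + s)
  have hs : s = 0 := by grind
  refine ⟨hs, ?_⟩
  obtain ⟨hc, ht⟩ := hst hs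
  grind

/-- A monomial equal to `-lam * X ^ s` has coefficient `-lam`. -/
theorem coeff_eq_neg_of_monomial_add_eq_zero {R : Type*} [CommRing R]
    {lam c : R} (hlam : lam ≠ 0) {s t : ℕ}
    (h : (C c * X ^ t + C lam * X ^ s : R[X]) = 0) : c = -lam := by
  have := congrArg (fun p => coeff p s) h
  simp only [coeff_add, coeff_C_mul_X_pow, coeff_zero] at this
  grind

/-- Lemma 3.2(2): for a monomial Rota-Baxter operator of nonzero weight `λ`,
either `β (θ n) = -λ` for all `n`, or `β (θ n) = 0` when `β n = 0` and
`β (θ n) = -λ` when `β n ≠ 0`. In particular `θ(S_β) ⊆ S_β` and `β 0` is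
either `0` or `-λ`. -/
theorem monomial_rota_baxter_nonzero_weight_beta_theta
    {R : Type*} [CommRing R] [IsDomain R] [Algebra ℚ R]
    (lam : R) (hlam : lam ≠ 0)
    (β : ℕ → R) (θ : ℕ → ℕ) (hconv : ∀ n, β n = 0 → θ n = 0)
    (P : Polynomial R →ₗ[R] Polynomial R)
    (hP : ∀ n : ℕ, P (X ^ n) = C (β n) * X ^ (θ n))
    (hRB : ∀ f g : Polynomial R,
      P f * P g = P (f * P g) + P (P f * g) + lam • P (f * g)) :
    ((∀ n : ℕ, β (θ n) = -lam) ∨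
      (∀ n : ℕ, (β n = 0 → β (θ n) = 0) ∧ (β n ≠ 0 → β (θ n) = -lam))) ∧
    (∀ n : ℕ, β n ≠ 0 → β (θ n) ≠ 0) ∧
    (β 0 = 0 ∨ β 0 = -lam) := by
  have hP1 : P 1 = C (β 0) * X ^ θ 0 := by simpa using hP 0
  have hPC (b : R) (n : ℕ) : P (C b * X ^ n) = C b * (C (β n) * X ^ θ n) := by
    rw [← smul_eq_C_mul, map_smul, hP, smul_eq_C_mul]
  have h0 : θ 0 = 0 ∧ (β 0 = 0 ∨ β 0 = -lam) := by
    by_cases hb : β 0 = 0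
    · exact ⟨hconv 0 hb, Or.inl hb⟩
    · have h := hRB 1 1
      simp only [one_mul, mul_one, hP1, hPC] at h
      exact (monomial_relation_at_zero hlam hb (fun h => by simp [h]) h).imp_right Or.inr
  obtain ⟨hθ0, hβ0⟩ := h0
  have hne (n : ℕ) (hn : β n ≠ 0) : β (θ n) = -lam := by
    have h := hRB (X ^ n) 1
    simp only [mul_one, hP1, hθ0, pow_zero, hP, hPC] at h
    rw [mul_comm (X ^ n), hPC, smul_eq_C_mul] at h
    apply coeff_eq_neg_of_monomial_add_eq_zero hlam (s := θ n) (t := θ (θ n))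
    apply mul_left_cancel₀ (C_ne_zero.mpr hn)
    linear_combination -h
  have hzero (n : ℕ) (hn : β n = 0) : β (θ n) = β 0 := by rw [hconv n hn]
  refine ⟨?_, fun n hn => by simpa [hne n hn] using hlam, hβ0⟩
  rcases hβ0 with hβ | hβ
  · exact Or.inr fun n => ⟨fun hn => (hzero n hn).trans hβ, hne n⟩
  · refine Or.inl fun n => ?_
    by_cases hn : β n = 0
    · exact (hzero n hn).trans hβ
    · exact hne n hn
end

section
/- Let λ ∈ k with λ ≠ 0, and let P be a monomial Rota-Baxter operator of weight λ on k[x] given by P(x^n) = β(n)·x^{θ(n)}. Then the zero set Z_θ = {n ∈ ℕ : θ(n) = 0} is closed under addition (for all m, n, if θ(m) = 0 and θ(n) = 0 then θ(m + n) = 0). Moreover, if there exists some n with β(n) = 0, then Z_θ = {0} ∪ Z_β; that is, for every n ∈ ℕ, θ(n) = 0 if and only if n = 0 or β(n) = 0. -/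
open Polynomial

/-- The Rota-Baxter identity on two monomials, read off coefficientwise. -/
theorem monomial_rota_baxter_coeff {R : Type*} [CommRing R] {lam : R} {β : ℕ → R} {θ : ℕ → ℕ}
    {P : Polynomial R →ₗ[R] Polynomial R}
    (hP : ∀ n : ℕ, P (X ^ n) = C (β n) * X ^ (θ n))
    (hRB : ∀ f g : Polynomial R,
      P f * P g = P (f * P g) + P (P f * g) + lam • P (f * g)) (m n d : ℕ) :
    (if d = θ m + θ n then β m * β n else 0) =
      (if d = θ (m + θ n) then β n * β (m + θ n) else 0) +
      (if d = θ (θ m + n) then β m * β (θ m + n) else 0) +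
      (if d = θ (m + n) then lam * β (m + n) else 0) := by
  have h := hRB (X ^ m) (X ^ n)
  have e₁ : (X : R[X]) ^ m * (C (β n) * X ^ θ n) = β n • X ^ (m + θ n) := by
    rw [smul_eq_C_mul, pow_add]; ring
  have e₂ : C (β m) * (X : R[X]) ^ θ m * X ^ n = β m • X ^ (θ m + n) := by
    rw [smul_eq_C_mul, pow_add]; ring
  have e₃ : C (β m) * (X : R[X]) ^ θ m * (C (β n) * X ^ θ n) =
      (β m * β n) • X ^ (θ m + θ n) := by
    rw [smul_eq_C_mul, C_mul, pow_add]; ring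
  rw [hP, hP, e₁, e₂, e₃, ← pow_add, map_smul, map_smul, hP, hP, hP] at h
  simpa [coeff_X_pow] using congrArg (fun p => coeff p d) h

/-- Lemma 3.2(3): for a monomial Rota-Baxter operator of nonzero weight `λ`,
`Z_θ` is a subsemigroup of `ℕ`; if `Z_β ≠ ∅` then `Z_θ = {0} ∪ Z_β`. -/
theorem monomial_rota_baxter_nonzero_weight_zero_set_theta
    {R : Type*} [CommRing R] [IsDomain R] [Algebra ℚ R]
    (lam : R) (hlam : lam ≠ 0)
    (β : ℕ → R) (θ : ℕ → ℕ) (hconv : ∀ n, β n = 0 → θ n = 0)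
    (P : Polynomial R →ₗ[R] Polynomial R)
    (hP : ∀ n : ℕ, P (X ^ n) = C (β n) * X ^ (θ n))
    (hRB : ∀ f g : Polynomial R,
      P f * P g = P (f * P g) + P (P f * g) + lam • P (f * g)) :
    (∀ m n : ℕ, θ m = 0 → θ n = 0 → θ (m + n) = 0) ∧
    ((∃ n : ℕ, β n = 0) → ∀ n : ℕ, θ n = 0 ↔ (n = 0 ∨ β n = 0)) := by
  have hc := monomial_rota_baxter_coeff hP hRB
  have theta_zero : θ 0 = 0 := by
    by_contra h0
    have hβ : β 0 ≠ 0 := fun h => h0 (hconv 0 h)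
    have h₁ := hc 0 0 (θ 0)
    have h₂ := hc 0 0 (θ 0 + θ 0)
    have hne : θ 0 ≠ θ 0 + θ 0 := by omega
    simp only [zero_add, add_zero, if_neg hne, if_neg hne.symm, if_true] at h₁ h₂
    by_cases hd : θ 0 = θ (θ 0)
    · simp [← hd, h0, hβ] at h₂
    · simp [hd, hlam, hβ] at h₁
  have theta_add : ∀ m n : ℕ, θ m = 0 → θ n = 0 → θ (m + n) = 0 := by
    intro m n hm hn
    by_contra h
    have h₁ := hc m n (θ (m + n))
    simp only [hm, hn, zero_add, add_zero, h, if_true, if_false] at h₁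
    exact h (hconv _ ((mul_eq_zero.mp h₁.symm).resolve_left hlam))
  have beta_add : ∀ m n : ℕ, θ m = 0 → θ n = 0 → lam * β (m + n) = -(β m * β n) := by
    intro m n hm hn
    have h₁ := hc m n 0
    simp only [hm, hn, theta_add m n hm hn, zero_add, add_zero, if_true] at h₁
    linear_combination -h₁
  have theta_mul : ∀ n : ℕ, θ n = 0 → ∀ j : ℕ, θ (j * n) = 0 := by
    intro n hn j
    induction j with
    | zero => simpa using theta_zero
    | succ j ih => rw [Nat.succ_mul]; exact theta_add _ _ ih hn
  refine ⟨theta_add, ?_⟩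
  rintro ⟨k, hk⟩ n
  refine ⟨fun hn => ?_, ?_⟩
  · by_contra! hcon
    obtain ⟨hn0, hβn⟩ := hcon
    have hθk := hconv k hk
    have beta_add_k : ∀ m : ℕ, θ m = 0 → β (m + k) = 0 := by
      intro m hm
      have h := beta_add m k hm hθk
      simpa [hk, hlam] using h
    have beta_mul_ne : ∀ j : ℕ, β ((j + 1) * n) ≠ 0 := by
      intro j
      induction j with
      | zero => simpa using hβn
      | succ j ih =>
        intro h
        have h' := beta_add ((j + 1) * n) n (theta_mul n hn _) hn
        rw [← Nat.succ_mul, h] at h'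
        simp [ih, hβn] at h'
    rcases Nat.eq_zero_or_pos k with rfl | hkpos
    · exact hβn (beta_add_k n hn)
    · obtain ⟨i, rfl⟩ := Nat.exists_eq_succ_of_ne_zero hn0
      obtain ⟨j, rfl⟩ := Nat.exists_eq_succ_of_ne_zero hkpos.ne'
      apply beta_mul_ne j
      have h := beta_add_k (i * (j + 1)) (theta_mul _ hθk i)
      convert h using 2
      simp only [Nat.succ_eq_add_one]; ring
  · rintro (rfl | h)
    · exact theta_zero
    · exact hconv n h
end

section
/- Let λ ∈ k with λ ≠ 0, and let P be a monomial Rota-Baxter operator of weight λ on k[x] given by P(x^n) = β(n)·x^{θ(n)}. Then the image im(θ) = {θ(n) : n ∈ ℕ} is closed under addition (for all a, b ∈ im(θ), a + b ∈ im(θ)), and im(θ) ∩ Z_θ = {0}, where Z_θ = {n ∈ ℕ : θ(n) = 0}. -/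
open Polynomial

/-- Lemma 3.2(4): for a monomial Rota-Baxter operator of nonzero weight `λ`,
`im(θ)` is a subsemigroup of `ℕ` and `im(θ) ∩ Z_θ = {0}`. -/
theorem monomial_rota_baxter_nonzero_weight_image_theta
    {R : Type*} [CommRing R] [IsDomain R] [Algebra ℚ R]
    (lam : R) (hlam : lam ≠ 0)
    (β : ℕ → R) (θ : ℕ → ℕ) (hconv : ∀ n, β n = 0 → θ n = 0)
    (P : Polynomial R →ₗ[R] Polynomial R)
    (hP : ∀ n : ℕ, P (X ^ n) = C (β n) * X ^ (θ n))
    (hRB : ∀ f g : Polynomial R,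
      P f * P g = P (f * P g) + P (P f * g) + lam • P (f * g)) :
    (∀ a b : ℕ, a ∈ Set.range θ → b ∈ Set.range θ → a + b ∈ Set.range θ) ∧
    Set.range θ ∩ {n : ℕ | θ n = 0} = {0} := by
  have key := monomial_rota_baxter_coeff hP hRB
  have h0 : θ 0 = 0 := by
    by_contra ht
    have hβ : β 0 ≠ 0 := fun h => ht (hconv 0 h)
    have h1 := key 0 0 (θ 0 + θ 0)
    have h2 := key 0 0 (θ 0)
    simp only [zero_add, add_zero] at h1 h2
    by_cases hd : θ (θ 0) = θ 0 + θ 0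
    · rw [hd] at h2
      simp [ht, hlam, hβ] at h2
    · simp [ht, hβ, Ne.symm hd] at h1
  refine ⟨?_, ?_⟩
  · rintro _ _ ⟨m, rfl⟩ ⟨n, rfl⟩
    by_cases hm : β m = 0
    · exact ⟨n, by simp [hconv m hm]⟩
    by_cases hn : β n = 0
    · exact ⟨m, by simp [hconv n hn]⟩
    by_contra hr
    have hne : ∀ k, θ m + θ n ≠ θ k := fun k hk => hr ⟨k, hk.symm⟩
    have h := key m n (θ m + θ n)
    simp [hne, hm, hn] at h
  · refine Set.eq_singleton_iff_unique_mem.2 ⟨⟨⟨0, h0⟩, h0⟩, ?_⟩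
    rintro _ ⟨⟨m, rfl⟩, hz : θ (θ m) = 0⟩
    by_contra ht
    have hβ : β m ≠ 0 := fun h => ht (hconv m h)
    have h := key m 0 (θ m)
    simp [h0, hz, ht, mul_comm (β m), hlam, hβ] at h
end

section
/- Let λ ∈ k with λ ≠ 0, and let P be a monomial Rota-Baxter operator of weight λ on k[x] given by P(x^n) = β(n)·x^{θ(n)}. Then Z_β + Z_θ ⊆ Z_β; that is, for all m, n ∈ ℕ, if β(m) = 0 and θ(n) = 0, then β(m + n) = 0. -/
open Polynomial

/-- For a monomial Rota-Baxter operator of nonzero weight `λ`,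
`Z_β + Z_θ ⊆ Z_β`. -/
theorem monomial_rota_baxter_nonzero_weight_zero_beta_add_zero_theta
    {R : Type*} [CommRing R] [IsDomain R] [Algebra ℚ R]
    (lam : R) (hlam : lam ≠ 0)
    (β : ℕ → R) (θ : ℕ → ℕ) (hconv : ∀ n, β n = 0 → θ n = 0)
    (P : Polynomial R →ₗ[R] Polynomial R)
    (hP : ∀ n : ℕ, P (X ^ n) = C (β n) * X ^ (θ n))
    (hRB : ∀ f g : Polynomial R,
      P f * P g = P (f * P g) + P (P f * g) + lam • P (f * g)) :
    ∀ m n : ℕ, β m = 0 → θ n = 0 → β (m + n) = 0 := by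
  intro m n hm hn
  have hPm : P (X ^ m) = 0 := by simp [hP, hm]
  have hPn : X ^ m * P (X ^ n) = β n • X ^ m := by
    rw [hP, hn, pow_zero, mul_one, mul_comm, C_mul']
  have h := hRB (X ^ m) (X ^ n)
  rw [hPn, map_smul, hPm, zero_mul, zero_mul, map_zero, smul_zero, zero_add, zero_add,
    ← pow_add, hP, eq_comm, smul_eq_zero_iff_right hlam] at h
  simpa using h
end

section
/- Let λ ∈ k with λ ≠ 0, and let P be a nonzero monomial Rota-Baxter operator of weight λ on k[x] given by P(x^n) = β(n)·x^{θ(n)}, and assume S_θ = ℕ* (i.e. θ(n) ≠ 0 for every n ≥ 1). Then for all positive integers n and all k ∈ ℕ, one has θ(n + θ(n)) = 2·θ(n) and θ(2^k·n) = 2^k·θ(n). -/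
open Polynomial

/-- If a sum of two monomials with nonzero coefficients is a monomial with nonzero coefficient,
then all three exponents agree. -/
theorem exponents_eq_of_monomial_eq_add {R : Type*} [Semiring R] {a b c : R} {i j l : ℕ}
    (ha : a ≠ 0) (hb : b ≠ 0) (hc : c ≠ 0)
    (h : C a * X ^ i = C b * X ^ j + C c * X ^ l) : j = i ∧ l = i := by
  have coeff_eq (m : ℕ) :
      (if m = i then a else 0) = (if m = j then b else 0) + (if m = l then c else 0) := by
    simpa only [coeff_add, coeff_C_mul_X_pow] using congrArg (fun p => coeff p m) h
  have hi := coeff_eq i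
  have hj := coeff_eq j
  have hl := coeff_eq l
  grind

/-- Comparing exponents in the Rota-Baxter identity for the pair `(X ^ n, X ^ n)`. -/
theorem theta_eq_two_mul_of_rota_baxter
    {R : Type*} [CommRing R] [IsDomain R] [CharZero R] {lam : R} (hlam : lam ≠ 0)
    {β : ℕ → R} {θ : ℕ → ℕ} {P : R[X] →ₗ[R] R[X]}
    (hP : ∀ n : ℕ, P (X ^ n) = C (β n) * X ^ (θ n))
    (hRB : ∀ f g : R[X], P f * P g = P (f * P g) + P (P f * g) + lam • P (f * g))
    {n : ℕ} (hn : β n ≠ 0) (hadd : β (n + θ n) ≠ 0) (hdouble : β (2 * n) ≠ 0) :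
    θ (n + θ n) = 2 * θ n ∧ θ (2 * n) = 2 * θ n := by
  refine exponents_eq_of_monomial_eq_add (a := β n * β n) (b := 2 * (β n * β (n + θ n)))
    (c := lam * β (2 * n)) (mul_ne_zero hn hn)
    (mul_ne_zero two_ne_zero (mul_ne_zero hn hadd)) (mul_ne_zero hlam hdouble) ?_
  have hright : P (X ^ n * P (X ^ n)) = C (β n * β (n + θ n)) * X ^ θ (n + θ n) := by
    rw [hP, mul_left_comm, ← pow_add, ← smul_eq_C_mul, map_smul, hP, smul_eq_C_mul, C_mul,
      mul_assoc]
  have h := hRB (X ^ n) (X ^ n)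
  rw [mul_comm (P (X ^ n)) (X ^ n), hright, ← pow_add, ← two_mul n, hP, hP, smul_eq_C_mul] at h
  simp only [C_mul, map_ofNat] at h ⊢
  linear_combination h

/-- Lemma 3.3(1): for a nonzero monomial Rota-Baxter operator of nonzero weight
with `S_θ = ℕ*`, one has `θ (n + θ n) = 2·θ n` and `θ (2^k·n) = 2^k·θ n` for
all positive `n` and all `k`. -/
theorem monomial_rota_baxter_nonzero_weight_theta_doubling
    {R : Type*} [CommRing R] [IsDomain R] [Algebra ℚ R]
    (lam : R) (hlam : lam ≠ 0)
    (β : ℕ → R) (θ : ℕ → ℕ) (hconv : ∀ n, β n = 0 → θ n = 0)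
    (P : Polynomial R →ₗ[R] Polynomial R)
    (hP : ∀ n : ℕ, P (X ^ n) = C (β n) * X ^ (θ n))
    (hRB : ∀ f g : Polynomial R,
      P f * P g = P (f * P g) + P (P f * g) + lam • P (f * g))
    (hnz : ∃ n : ℕ, β n ≠ 0)
    (hSθ : ∀ n : ℕ, θ n ≠ 0 ↔ n ≠ 0) :
    ∀ n : ℕ, 0 < n → ∀ k : ℕ,
      θ (n + θ n) = 2 * θ n ∧ θ (2 ^ k * n) = 2 ^ k * θ n := by
  have : CharZero R := algebraRat.charZero R
  have hβ (n : ℕ) (hn : 0 < n) : β n ≠ 0 := fun h => (hSθ n).2 hn.ne' (hconv n h)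
  have key (n : ℕ) (hn : 0 < n) : θ (n + θ n) = 2 * θ n ∧ θ (2 * n) = 2 * θ n :=
    theta_eq_two_mul_of_rota_baxter hlam hP hRB (hβ n hn) (hβ _ (by lia)) (hβ _ (by lia))
  intro n hn k
  refine ⟨(key n hn).1, ?_⟩
  induction k with
  | zero => simp
  | succ k ih => rw [pow_succ', mul_assoc, (key _ (by positivity)).2, ih, mul_assoc]
end

section
/- Let λ ∈ k with λ ≠ 0, and let P be a nonzero monomial Rota-Baxter operator of weight λ on k[x] given by P(x^n) = β(n)·x^{θ(n)}, and assume S_θ = ℕ* (i.e. θ(n) ≠ 0 for every n ≥ 1, and θ(0) = 0). Then θ(n) = n for all n ∈ ℕ. -/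
open Polynomial

/-- The coefficientwise form of the Rota-Baxter identity of weight `-1` for the monomial operator
`x ^ n ↦ c n * x ^ θ n`. -/
def MonomialRotaBaxterCoeff {K : Type*} [Ring K] (c : ℕ → K) (θ : ℕ → ℕ) : Prop :=
  ∀ m n N : ℕ, (if θ m + θ n = N then c m * c n else 0) =
    (if θ (m + θ n) = N then c n * c (m + θ n) else 0) +
    (if θ (n + θ m) = N then c m * c (n + θ m) else 0) -
    (if θ (m + n) = N then c (m + n) else 0)

namespace MonomialRotaBaxterCoeff

variable {K : Type*} [Field K] {c : ℕ → K} {θ : ℕ → ℕ}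

/-- Dividing by `-l` turns an operator of weight `l` into one of weight `-1`. -/
theorem of_weight {b : ℕ → K} {l : K} (hl : l ≠ 0)
    (h : ∀ m n N : ℕ, (if θ m + θ n = N then b m * b n else 0) =
      (if θ (m + θ n) = N then b n * b (m + θ n) else 0) +
      (if θ (n + θ m) = N then b m * b (n + θ m) else 0) +
      (if θ (m + n) = N then l * b (m + n) else 0)) :
    MonomialRotaBaxterCoeff (fun n => -(b n / l)) θ := by
  intro m n N
  have e := congrArg (fun x => x / l ^ 2) (h m n N)
  convert e using 1
  · split_ifs
    · field_simp
    · simp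
  · split_ifs <;> field_simp <;> ring

/-- The identity with all the exponents involved given in a prescribed form. -/
theorem eq_of_exponents (h : MonomialRotaBaxterCoeff c θ) {p q A B s t u v : ℕ}
    (hA : θ p = A) (hB : θ q = B) (hs : p + B = s) (ht : q + A = t) (hu : p + q = u)
    (hv : A + B = v) (N : ℕ) :
    (if v = N then c p * c q else 0) = (if θ s = N then c q * c s else 0) +
      (if θ t = N then c p * c t else 0) - (if θ u = N then c u else 0) := by
  subst hA hB hs ht hu hv
  exact h p q N

/-- Every value of `θ` is a fixed point of `θ`, with coefficient one. -/
theorem apply_apply (h : MonomialRotaBaxterCoeff c θ) (h0 : θ 0 = 0)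
    (hc : ∀ n, n ≠ 0 → c n ≠ 0) {n : ℕ} (hn : n ≠ 0) :
    θ (θ n) = θ n ∧ c (θ n) = 1 := by
  have e := h.eq_of_exponents (p := n) (q := 0) rfl h0 (add_zero n) (zero_add _) (add_zero n)
    (add_zero _) (θ n)
  have hcn := hc n hn
  by_cases hf : θ (θ n) = θ n
  · refine ⟨hf, mul_left_cancel₀ hcn ?_⟩
    simp only [hf, if_true] at e
    linear_combination -e
  · simp only [hf, if_true, if_false] at e
    exact absurd (by linear_combination e) hcn

/-- Sums of nonzero fixed points of `θ` are fixed points. -/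
theorem apply_add_of_fixed (h : MonomialRotaBaxterCoeff c θ)
    (hc : ∀ n, n ≠ 0 → c n ≠ 0) {p q : ℕ} (hp : p ≠ 0) (hq : q ≠ 0)
    (hfp : θ p = p) (hfq : θ q = q) : θ (p + q) = p + q := by
  have e := h.eq_of_exponents hfp hfq rfl (add_comm q p) rfl rfl (p + q)
  by_contra hne
  simp only [hne, if_true, if_false] at e
  exact mul_ne_zero (hc p hp) (hc q hq) (by linear_combination e)

theorem apply_mul_of_fixed (h : MonomialRotaBaxterCoeff c θ) (h0 : θ 0 = 0)
    (hc : ∀ n, n ≠ 0 → c n ≠ 0) {a : ℕ} (ha : a ≠ 0) (hfa : θ a = a) (j : ℕ) :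
    θ (j * a) = j * a := by
  induction j with
  | zero => simpa using h0
  | succ j ih =>
    rcases Nat.eq_zero_or_pos j with rfl | hj
    · simpa using hfa
    · rw [Nat.succ_mul]
      exact h.apply_add_of_fixed hc (by positivity) ha ih hfa

/-- The inductive step for `m + (r + 1) * θ m`: if `θ (i * m + j * a) = (i + j) * a` whenever
`0 < i + j < r + 2`, then it also holds for `i = 1`, `j = r + 1`. -/
theorem apply_add_mul [CharZero K] (h : MonomialRotaBaxterCoeff c θ)
    (hc : ∀ n, n ≠ 0 → c n ≠ 0) {m a : ℕ} (hm : m ≠ 0) {r : ℕ}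
    (ih : ∀ i j, 0 < i + j → i + j < r + 2 → θ (i * m + j * a) = (i + j) * a) :
    θ (m + (r + 1) * a) = (r + 2) * a := by
  by_contra hne
  have hne' : ¬ (r + 2) * a = θ (m + (r + 1) * a) := fun h' => hne h'.symm
  have hcm : ∀ i j, c ((i + 1) * m + j * a) ≠ 0 := fun i j => hc _ (by positivity)
  have hcr : c (m + (r + 1) * a) ≠ 0 := hc _ (by positivity)
  have pair : ∀ s t, s + t = r → ∀ N, _ := fun s t hst N =>
    h.eq_of_exponents (p := (0 + 1) * m + s * a) (q := (0 + 1) * m + t * a)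
      (s := m + (r + 1) * a) (t := m + (r + 1) * a) (u := 2 * m + r * a) (v := (r + 2) * a)
      (ih _ _ (by omega) (by omega)) (ih _ _ (by omega) (by omega))
      (by subst hst; ring) (by subst hst; ring) (by subst hst; ring) (by subst hst; ring) N
  have hθ2 : θ (2 * m + r * a) = (r + 2) * a := by
    by_contra h2
    have e := pair 0 r (zero_add r) ((r + 2) * a)
    simp only [hne, h2, if_true, if_false] at e
    exact mul_ne_zero (hcm 0 0) (hcm 0 r) (by linear_combination e)
  have hneg : ∀ s t, s + t = r → c ((0 + 1) * m + s * a) + c ((0 + 1) * m + t * a) = 0 := by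
    intro s t hst
    have e := pair s t hst (θ (m + (r + 1) * a))
    simp only [hθ2, hne', if_true, if_false] at e
    refine (mul_eq_zero.mp ?_).resolve_right hcr
    linear_combination -e
  have hsq : ∀ s t, s + t = r →
      c ((0 + 1) * m + s * a) * c ((0 + 1) * m + t * a) = - c (2 * m + r * a) := by
    intro s t hst
    have e := pair s t hst ((r + 2) * a)
    simp only [hθ2, hne, if_true, if_false] at e
    linear_combination e
  have htwo : ∀ s, s < r → c ((1 + 1) * m + s * a) = c (2 * m + r * a) := by
    intro s hs
    obtain ⟨t, rfl⟩ : ∃ t, r = s + t + 1 := ⟨r - s - 1, by omega⟩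
    have E := h.eq_of_exponents (p := (0 + 1) * m + t * a) (q := (1 + 1) * m + s * a)
      (s := m + (s + t + 1 + 1) * a) (t := 2 * m + (s + t + 1) * a) (u := 3 * m + (s + t) * a)
      (v := (s + t + 1 + 2) * a)
      (ih _ _ (by omega) (by omega)) (ih _ _ (by omega) (by omega))
      (by ring) (by ring) (by ring) (by ring)
    have e₁ := E (θ (m + (s + t + 1 + 1) * a))
    have h3 : θ (3 * m + (s + t) * a) = θ (m + (s + t + 1 + 1) * a) := by
      by_contra h3
      simp only [hθ2, hne', h3, if_true, if_false] at e₁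
      exact mul_ne_zero (hcm 1 s) hcr (by linear_combination -e₁)
    have e₂ := E ((s + t + 1 + 2) * a)
    simp only [hθ2, h3, hne, if_true, if_false] at e₂
    exact mul_left_cancel₀ (hcm 0 t) (by linear_combination e₂)
  have hconst : ∀ s, s ≤ r → c ((0 + 1) * m + s * a) = c ((0 + 1) * m + 0 * a) := by
    intro s
    induction s with
    | zero => intro _; rfl
    | succ s ihs =>
      intro hs
      have es := ihs (by omega)
      have e := h.eq_of_exponents (p := (0 + 1) * m + 0 * a) (q := (0 + 1) * m + s * a)
        (s := (0 + 1) * m + (s + 1) * a) (t := (0 + 1) * m + (s + 1) * a)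
        (u := (1 + 1) * m + s * a) (v := (s + 2) * a)
        (ih _ _ (by omega) (by omega)) (ih _ _ (by omega) (by omega))
        (by ring) (by ring) (by ring) (by ring) ((s + 2) * a)
      have h1 : θ ((0 + 1) * m + (s + 1) * a) = (s + 2) * a := by
        rw [ih _ _ (by omega) (by omega)]; ring
      have h2 : θ ((1 + 1) * m + s * a) = (s + 2) * a := by
        rw [ih _ _ (by omega) (by omega)]; ring
      simp only [h1, h2, if_true, es, htwo s (by omega)] at e
      have hr := hneg 0 r (zero_add r)
      have hr' := hsq 0 r (zero_add r)
      refine mul_left_cancel₀ (mul_ne_zero two_ne_zero (hcm 0 0)) ?_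
      linear_combination -e + hr' - c ((0 + 1) * m + 0 * a) * hr
  have hz := hneg 0 r (zero_add r)
  rw [hconst r le_rfl, ← two_mul] at hz
  exact mul_ne_zero two_ne_zero (hcm 0 0) hz

theorem apply_combination [CharZero K] (h : MonomialRotaBaxterCoeff c θ) (h0 : θ 0 = 0)
    (hc : ∀ n, n ≠ 0 → c n ≠ 0) (hθ : ∀ n, n ≠ 0 → θ n ≠ 0) {m : ℕ} (hm : m ≠ 0) (r : ℕ) :
    ∀ i j, 0 < i + j → i + j = r → θ (i * m + j * θ m) = (i + j) * θ m := by
  induction r using Nat.strong_induction_on with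
  | _ r ih =>
    have hfix := h.apply_mul_of_fixed h0 hc (hθ m hm) (h.apply_apply h0 hc hm).1
    intro i
    induction i with
    | zero =>
      intro j _ _
      simpa using hfix j
    | succ i ihi =>
      intro j _ hij
      rcases Nat.lt_or_ge r 2 with hr | hr
      · obtain ⟨rfl, rfl⟩ : i = 0 ∧ j = 0 := by omega
        simp
      obtain ⟨r, rfl⟩ : ∃ k, r = k + 2 := ⟨r - 2, by omega⟩
      have h1 : θ (m + (r + 1) * θ m) = (r + 2) * θ m :=
        h.apply_add_mul hc hm fun i j hpos hlt => ih _ hlt i j hpos rfl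
      rcases Nat.eq_zero_or_pos i with rfl | hi
      · obtain rfl : j = r + 1 := by omega
        convert h1 using 2
        ring
      have hi' : θ (i * m + (j + 1) * θ m) = (r + 2) * θ m := by
        rw [ihi (j + 1) (by omega) (by omega)]
        congr 1
        omega
      have hr' : r + 1 = i + j := by omega
      have e := h.eq_of_exponents (p := 1 * m + 0 * θ m) (q := i * m + j * θ m)
        (s := m + (r + 1) * θ m) (t := i * m + (j + 1) * θ m) (u := (i + 1) * m + j * θ m)
        (v := (r + 2) * θ m)
        (ih 1 (by omega) 1 0 (by omega) rfl) (ih (i + j) (by omega) i j (by omega) rfl)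
        (by rw [hr']; ring) (by ring) (by ring)
        (by rw [show r + 2 = i + j + 1 by omega]; ring)
        (θ ((i + 1) * m + j * θ m))
      rw [hij]
      by_contra hne
      have hne' : ¬ (r + 2) * θ m = θ ((i + 1) * m + j * θ m) := fun h' => hne h'.symm
      simp only [h1, hi', hne', if_true, if_false] at e
      exact hc ((i + 1) * m + j * θ m) (by positivity) (by linear_combination e)

theorem apply_eq_self [CharZero K] (h : MonomialRotaBaxterCoeff c θ) (h0 : θ 0 = 0)
    (hc : ∀ n, n ≠ 0 → c n ≠ 0) (hθ : ∀ n, n ≠ 0 → θ n ≠ 0) {m : ℕ} (hm : m ≠ 0) :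
    θ m = m := by
  have h1 := h.apply_combination h0 hc hθ hm _ (θ m) 0 (Nat.pos_of_ne_zero (hθ m hm)) rfl
  have h2 := h.apply_mul_of_fixed h0 hc (hθ m hm) (h.apply_apply h0 hc hm).1 m
  rw [zero_mul, add_zero, add_zero, mul_comm (θ m) m, h2] at h1
  exact (Nat.eq_of_mul_eq_mul_right (Nat.pos_of_ne_zero (hθ m hm)) h1).symm

end MonomialRotaBaxterCoeff

/-- Lemma 3.4: for a nonzero monomial Rota-Baxter operator of nonzero weight
with `S_θ = ℕ*`, one has `θ n = n` for all `n`. -/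
theorem monomial_rota_baxter_nonzero_weight_theta_eq_id
    {R : Type*} [CommRing R] [IsDomain R] [Algebra ℚ R]
    (lam : R) (hlam : lam ≠ 0)
    (β : ℕ → R) (θ : ℕ → ℕ) (hconv : ∀ n, β n = 0 → θ n = 0)
    (P : Polynomial R →ₗ[R] Polynomial R)
    (hP : ∀ n : ℕ, P (X ^ n) = C (β n) * X ^ (θ n))
    (hRB : ∀ f g : Polynomial R,
      P f * P g = P (f * P g) + P (P f * g) + lam • P (f * g))
    (hnz : ∃ n : ℕ, β n ≠ 0)
    (hSθ : ∀ n : ℕ, θ n ≠ 0 ↔ n ≠ 0) :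
    ∀ n : ℕ, θ n = n := by
  have h0 : θ 0 = 0 := by simpa using hSθ 0
  have hβ : ∀ n, n ≠ 0 → β n ≠ 0 := fun n hn hb => (hSθ n).mpr hn (hconv n hb)
  have hcoeff : ∀ m n N : ℕ, (if θ m + θ n = N then β m * β n else 0) =
      (if θ (m + θ n) = N then β n * β (m + θ n) else 0) +
      (if θ (n + θ m) = N then β m * β (n + θ m) else 0) +
      (if θ (m + n) = N then lam * β (m + n) else 0) := by
    intro m n N
    have e := hRB (X ^ m) (X ^ n)
    rw [hP m, hP n,
      show (X : R[X]) ^ m * (C (β n) * X ^ θ n) = β n • X ^ (m + θ n) by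
        rw [smul_eq_C_mul]; ring,
      show C (β m) * X ^ θ m * (X : R[X]) ^ n = β m • X ^ (n + θ m) by
        rw [smul_eq_C_mul]; ring,
      show C (β m) * X ^ θ m * (C (β n) * (X : R[X]) ^ θ n) =
          C (β m * β n) * X ^ (θ m + θ n) by rw [C_mul]; ring,
      ← pow_add, map_smul, map_smul, hP, hP, hP] at e
    have e' := congrArg (fun p => coeff p N) e
    simpa [-map_mul, coeff_X_pow, eq_comm (a := N)] using e'
  have : CharZero R := algebraRat.charZero R
  let K := FractionRing R
  have : CharZero K := charZero_of_injective_algebraMap (IsFractionRing.injective R K)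
  have hinj : ∀ x : R, x ≠ 0 → algebraMap R K x ≠ 0 := fun x hx =>
    (map_ne_zero_iff _ (IsFractionRing.injective R K)).mpr hx
  have hl := hinj lam hlam
  have H : MonomialRotaBaxterCoeff
      (fun n => -(algebraMap R K (β n) / algebraMap R K lam)) θ := by
    refine .of_weight hl fun m n N => ?_
    simpa only [map_add, apply_ite (algebraMap R K), map_mul, map_zero] using
      congrArg (algebraMap R K) (hcoeff m n N)
  intro n
  rcases eq_or_ne n 0 with rfl | hn
  · exact h0
  · exact H.apply_eq_self h0 (fun n hn => neg_ne_zero.mpr (div_ne_zero (hinj _ (hβ n hn)) hl))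
      (fun n hn => (hSθ n).mpr hn) hn
end

section
/- Let λ ∈ k with λ ≠ 0, and let P be a nonzero monomial linear operator on k[x] given by P(x^n) = β(n)·x^{θ(n)}. Then P is a Rota-Baxter operator of weight λ if and only if P has one of the following four forms: (1) there exists b ∈ k with b ≠ 0 such that θ(n) = 0 and (−λ)^n·β(n) = (−λ)·b^n for all n ∈ ℕ (i.e. P(x^n) = (−λ)^{1−n}·b^n); (2) θ(n) = n and β(n) = −λ for all n ∈ ℕ (i.e. P(x^n) = −λ·x^n); (3) θ(0) = 0, β(0) = 0, and θ(n) = n, β(n) = −λ for all n ≥ 1; or (4) θ(n) = 0 for all n, β(0) = −λ, and β(n) = 0 for all n ≥ 1. -/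
open Polynomial

/-- The Rota-Baxter identity for a monomial operator only has to be checked on monomials. -/
theorem rotaBaxter_iff_monomials {R : Type*} [CommRing R] (lam : R)
    (β : ℕ → R) (θ : ℕ → ℕ) (P : R[X] →ₗ[R] R[X])
    (hP : ∀ n : ℕ, P (X ^ n) = C (β n) * X ^ (θ n)) :
    (∀ f g : R[X], P f * P g = P (f * P g) + P (P f * g) + lam • P (f * g)) ↔
      ∀ m n : ℕ, C (β m * β n) * X ^ (θ m + θ n) =
        C (β n * β (m + θ n)) * X ^ (θ (m + θ n)) +
        C (β m * β (n + θ m)) * X ^ (θ (n + θ m)) +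
        C (lam * β (m + n)) * X ^ (θ (m + n)) := by
  have hmon : ∀ m n : ℕ, (P (X ^ m) * P (X ^ n) =
      P (X ^ m * P (X ^ n)) + P (P (X ^ m) * X ^ n) + lam • P (X ^ m * X ^ n)) ↔
      C (β m * β n) * X ^ (θ m + θ n) =
        C (β n * β (m + θ n)) * X ^ (θ (m + θ n)) +
        C (β m * β (n + θ m)) * X ^ (θ (n + θ m)) +
        C (lam * β (m + n)) * X ^ (θ (m + n)) := by
    intro m n
    have h1 : P (X ^ m * P (X ^ n)) = C (β n * β (m + θ n)) * X ^ (θ (m + θ n)) := by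
      rw [hP n, show (X : R[X]) ^ m * (C (β n) * X ^ θ n) = β n • X ^ (m + θ n) by
        rw [smul_eq_C_mul]; ring, map_smul, hP, smul_eq_C_mul, C_mul, mul_assoc]
    have h2 : P (P (X ^ m) * X ^ n) = C (β m * β (n + θ m)) * X ^ (θ (n + θ m)) := by
      rw [hP m, show (C (β m) * X ^ θ m) * (X : R[X]) ^ n = β m • X ^ (n + θ m) by
        rw [smul_eq_C_mul]; ring, map_smul, hP, smul_eq_C_mul, C_mul, mul_assoc]
    have h3 : P (X ^ m) * P (X ^ n) = C (β m * β n) * X ^ (θ m + θ n) := by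
      rw [hP, hP, C_mul]; ring
    rw [h1, h2, h3, ← pow_add, hP, smul_eq_C_mul, C_mul (a := lam), mul_assoc (C lam)]
  refine ⟨fun h m n => (hmon m n).1 (h _ _), fun h f g => ?_⟩
  induction f using Polynomial.induction_on' with
  | add f₁ f₂ h₁ h₂ =>
    simp only [add_mul, map_add, smul_add] at *
    linear_combination h₁ + h₂
  | monomial m a =>
    induction g using Polynomial.induction_on' with
    | add g₁ g₂ h₁ h₂ =>
      simp only [mul_add, map_add, smul_add] at *
      linear_combination h₁ + h₂
    | monomial n b =>
      have := (hmon m n).2 (h m n)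
      rw [← C_mul_X_pow_eq_monomial, ← C_mul_X_pow_eq_monomial, ← smul_eq_C_mul, ← smul_eq_C_mul]
      simp only [map_smul, smul_mul_assoc, mul_smul_comm, this, smul_add, smul_comm lam]

/-- The coefficient of `x ^ r` in the image `e n * x ^ θ n` of `x ^ n`. -/
def imageCoeff {K : Type*} [Zero K] (e : ℕ → K) (θ : ℕ → ℕ) (n r : ℕ) : K := if θ n = r then e n else 0

theorem imageCoeff_self {K : Type*} [Zero K] {e : ℕ → K} {θ : ℕ → ℕ}
    (n : ℕ) : imageCoeff e θ n (θ n) = e n := if_pos rfl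

theorem imageCoeff_of_eq {K : Type*} [Zero K] {e : ℕ → K} {θ : ℕ → ℕ}
    {n r : ℕ} (h : θ n = r) : imageCoeff e θ n r = e n := if_pos h

theorem imageCoeff_of_ne {K : Type*} [Zero K] {e : ℕ → K} {θ : ℕ → ℕ}
    {n r : ℕ} (h : θ n ≠ r) : imageCoeff e θ n r = 0 := if_neg h

section Projection

variable {K : Type*} [Field K] {e : ℕ → K} {θ : ℕ → ℕ}

theorem imageCoeff_eq_zero_of_ne_zero {n r t : ℕ} (h : imageCoeff e θ n r ≠ 0) (hrt : r ≠ t) :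
    imageCoeff e θ n t = 0 := by
  unfold imageCoeff at *
  grind

/-- If the image of the monomial projection `x ^ n ↦ e n * x ^ θ n` is a subalgebra with
complement (the kernel) closed under multiplication, then the exponents `i * m + j * s`, where
`s = θ m`, are sent to `(i + j) * s`. -/
theorem exponent_homogeneous (h2 : (2 : K) ≠ 0)
    (H : ∀ m n r, (if θ m + θ n = r then e m * e n else 0) =
      e n * imageCoeff e θ (m + θ n) r + e m * imageCoeff e θ (n + θ m) r -
        imageCoeff e θ (m + n) r)
    {m s : ℕ} (hms : θ m = s) (hne : ∀ i j, 1 ≤ i + j → e (i * m + j * s) ≠ 0)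
    (hs : ∀ N, 1 ≤ N → θ (N * s) = N * s ∧ e (N * s) = 1) (N : ℕ) (hN : 1 ≤ N) :
    (∀ i j, i + j = N → θ (i * m + j * s) = N * s) ∧
      ¬ ∀ i j, i + j = N → e (i * m + j * s) = (-e m) ^ i := by
  have he : e m ≠ 0 := by simpa using hne 1 0 (by simp)
  induction N, hN using Nat.le_induction with
  | base =>
    have hs1 := hs 1 le_rfl
    constructor
    · intro i j hij
      obtain ⟨rfl, rfl⟩ | ⟨rfl, rfl⟩ : (i = 0 ∧ j = 1) ∨ (i = 1 ∧ j = 0) := by omega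
      · simpa using hs1.1
      · simpa using hms
    · intro h
      have h1 := h 1 0 rfl
      simp only [one_mul, zero_mul, add_zero, pow_one] at h1
      exact mul_ne_zero h2 he (by linear_combination h1)
  | succ N hN ih =>
    obtain ⟨hG, hD⟩ := ih
    have key : ∀ i j, i + j = N → ∀ r,
        (if (N + 1) * s = r then e m * e (i * m + j * s) else 0) =
        e (i * m + j * s) * imageCoeff e θ (1 * m + N * s) r +
          e m * imageCoeff e θ (i * m + (j + 1) * s) r -
          imageCoeff e θ ((i + 1) * m + j * s) r := by
      intro i j hij r
      have := H m (i * m + j * s) r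
      rw [hG i j hij, hms] at this
      rwa [show s + N * s = (N + 1) * s by ring, show m + N * s = 1 * m + N * s by ring,
        show i * m + j * s + s = i * m + (j + 1) * s by ring,
        show m + (i * m + j * s) = (i + 1) * m + j * s by ring] at this
    have hθ : θ (1 * m + N * s) = (N + 1) * s := by
      by_contra hr
      apply hD
      set T := (N + 1) * s with hT
      set c := e (1 * m + N * s)
      set r := θ (1 * m + N * s)
      have hc0 : c ≠ 0 := hne 1 N (by omega)
      have hcT : imageCoeff e θ (1 * m + N * s) T = 0 := imageCoeff_of_ne hr
      have hcr : imageCoeff e θ (1 * m + N * s) r = c := imageCoeff_self _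
      have step : ∀ i j, i + j = N →
          ((imageCoeff e θ (i * m + (j + 1) * s) T = (-e m) ^ i ∧
            imageCoeff e θ (i * m + (j + 1) * s) r = 0) ∨
          (imageCoeff e θ (i * m + (j + 1) * s) T = 0 ∧
            e m * imageCoeff e θ (i * m + (j + 1) * s) r = -c * (-e m) ^ i)) →
          e (i * m + j * s) = (-e m) ^ i ∧
          ((imageCoeff e θ ((i + 1) * m + j * s) T = (-e m) ^ (i + 1) ∧
            imageCoeff e θ ((i + 1) * m + j * s) r = 0) ∨
          (imageCoeff e θ ((i + 1) * m + j * s) T = 0 ∧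
            e m * imageCoeff e θ ((i + 1) * m + j * s) r = -c * (-e m) ^ (i + 1))) := by
        intro i j hij h
        have hε := hne i j (by omega)
        have kT := key i j hij T
        have kr := key i j hij r
        rw [if_pos rfl, hcT] at kT
        rw [if_neg (Ne.symm hr), hcr] at kr
        rcases h with ⟨hT', hr'⟩ | ⟨hT', hr'⟩
        · rw [hT'] at kT
          rw [hr'] at kr
          have hr1 : imageCoeff e θ ((i + 1) * m + j * s) r = e (i * m + j * s) * c := by
            linear_combination kr
          have hT1 := imageCoeff_eq_zero_of_ne_zero (hr1 ▸ mul_ne_zero hε hc0) hr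
          rw [hT1] at kT
          have hw : e (i * m + j * s) = (-e m) ^ i :=
            mul_left_cancel₀ he (by linear_combination kT)
          exact ⟨hw, Or.inr ⟨hT1, by rw [hr1, hw]; ring⟩⟩
        · rw [hT'] at kT
          have hT1 : imageCoeff e θ ((i + 1) * m + j * s) T = -(e m * e (i * m + j * s)) := by
            linear_combination kT
          have hr1 := imageCoeff_eq_zero_of_ne_zero
            (hT1 ▸ neg_ne_zero.2 (mul_ne_zero he hε)) (Ne.symm hr)
          rw [hr1] at kr
          have hw : e (i * m + j * s) = (-e m) ^ i :=
            mul_left_cancel₀ hc0 (by linear_combination -kr - hr')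
          exact ⟨hw, Or.inl ⟨by rw [hT1, hw]; ring, hr1⟩⟩
      have inv : ∀ i j, i + j = N + 1 →
          (imageCoeff e θ (i * m + j * s) T = (-e m) ^ i ∧
            imageCoeff e θ (i * m + j * s) r = 0) ∨
          (imageCoeff e θ (i * m + j * s) T = 0 ∧
            e m * imageCoeff e θ (i * m + j * s) r = -c * (-e m) ^ i) := by
        intro i
        induction i with
        | zero =>
          intro j hj
          obtain rfl : j = N + 1 := by omega
          have hTs := hs (N + 1) (by omega)
          left
          rw [zero_mul, zero_add, ← hT, pow_zero] at *
          exact ⟨by rw [imageCoeff_of_eq hTs.1, hTs.2],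
            imageCoeff_of_ne (by rw [hTs.1]; exact Ne.symm hr)⟩
        | succ i ih =>
          intro j hj
          exact (step i j (by omega) (ih (j + 1) (by omega))).2
      exact fun i j hij => (step i j hij (inv i (j + 1) (by omega))).1
    have hG' : ∀ i j, i + j = N + 1 → θ (i * m + j * s) = (N + 1) * s := by
      intro i
      induction i with
      | zero =>
        intro j hj
        obtain rfl : j = N + 1 := by omega
        simpa using (hs (N + 1) (by omega)).1
      | succ i ih =>
        intro j hj
        by_contra hr
        have h := key i j (by omega) (θ ((i + 1) * m + j * s))
        rw [if_neg (Ne.symm hr), imageCoeff_self, imageCoeff_of_ne (by rw [hθ]; exact Ne.symm hr),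
          imageCoeff_of_ne (by rw [ih (j + 1) (by omega)]; exact Ne.symm hr)] at h
        exact hne (i + 1) j (by omega) (by linear_combination h)
    refine ⟨hG', fun h => hD fun i j hij => ?_⟩
    have h1 := key i j hij ((N + 1) * s)
    rw [if_pos rfl, imageCoeff_of_eq hθ, imageCoeff_of_eq (hG' i (j + 1) (by omega)),
      imageCoeff_of_eq (hG' (i + 1) j (by omega)), h 1 N (by omega), h i (j + 1) (by omega),
      h (i + 1) j (by omega)] at h1
    exact mul_left_cancel₀ (mul_ne_zero h2 he) (by linear_combination h1)

/-- A monomial projection with multiplicatively closed image and kernel that fixes some `x ^ p`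
with `p` positive fixes every positive power of `x`. -/
theorem fixes_positive_powers (h2 : (2 : K) ≠ 0)
    (H : ∀ m n r, (if θ m + θ n = r then e m * e n else 0) =
      e n * imageCoeff e θ (m + θ n) r + e m * imageCoeff e θ (n + θ m) r -
        imageCoeff e θ (m + n) r)
    (hid : ∀ n, e n ≠ 0 → θ (θ n) = θ n ∧ e (θ n) = 1)
    {p : ℕ} (hp : 0 < p) (hθp : θ p = p) (hep : e p = 1) {m : ℕ} (hm : 0 < m) :
    θ m = m ∧ e m = 1 := by
  have hadd : ∀ a b, (θ a = a ∧ e a = 1) → (θ b = b ∧ e b = 1) →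
      (θ (a + b) = a + b ∧ e (a + b) = 1) := by
    rintro a b ⟨ha, ha'⟩ ⟨hb, hb'⟩
    have h := H a b (a + b)
    rw [ha, hb, ha', hb', add_comm b a, if_pos rfl] at h
    have h' : imageCoeff e θ (a + b) (a + b) = 1 := by linear_combination -h
    unfold imageCoeff at h'
    split_ifs at h' with h''
    · exact ⟨h'', h'⟩
    · exact absurd h' zero_ne_one
  have hmul : ∀ a, (θ a = a ∧ e a = 1) → ∀ N, 1 ≤ N → (θ (N * a) = N * a ∧ e (N * a) = 1) := by
    intro a ha N hN
    induction N, hN using Nat.le_induction with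
    | base => simpa using ha
    | succ N hN ih => rw [add_mul, one_mul]; exact hadd _ _ ih ha
  have hnz : ∀ n, 0 < n → e n ≠ 0 := by
    intro n hn h0
    have hz : ∀ N, 1 ≤ N → e (N * n) = 0 := by
      intro N hN
      induction N, hN using Nat.le_induction with
      | base => simpa using h0
      | succ N hN ih =>
        have h := H (N * n) n (θ (N * n + n))
        rw [ih, h0, imageCoeff_self] at h
        rw [add_mul, one_mul]
        simpa using h
    have h1 := (hmul p ⟨hθp, hep⟩ n hn).2
    rw [mul_comm, hz p hp] at h1
    exact zero_ne_one h1
  have hs := hmul _ (hid m (hnz m hm))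
  have hne : ∀ i j, 1 ≤ i + j → e (i * m + j * θ m) ≠ 0 := by
    intro i j hij
    rcases Nat.eq_zero_or_pos i with rfl | hi
    · rw [zero_mul, zero_add, (hs j (by omega)).2]
      exact one_ne_zero
    · exact hnz _ (by positivity)
  have h1 := (exponent_homogeneous h2 H rfl hne hs p hp).1 p 0 rfl
  rw [zero_mul, add_zero, mul_comm p m, (hmul p ⟨hθp, hep⟩ m hm).1, mul_comm m p] at h1
  have h3 : θ m = m := (Nat.eq_of_mul_eq_mul_left hp h1).symm
  have h4 := (hid m (hnz m hm)).2
  rw [h3] at h4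
  exact ⟨h3, h4⟩

end Projection

section Domain

variable {R : Type*} [CommRing R] {lam : R} {β : ℕ → R} {θ : ℕ → ℕ}

theorem coeff_identity
    (h : ∀ m n : ℕ, C (β m * β n) * (X : R[X]) ^ (θ m + θ n) =
      C (β n * β (m + θ n)) * X ^ (θ (m + θ n)) +
      C (β m * β (n + θ m)) * X ^ (θ (n + θ m)) +
      C (lam * β (m + n)) * X ^ (θ (m + n))) (m n r : ℕ) :
    (if θ m + θ n = r then β m * β n else 0) =
      β n * imageCoeff β θ (m + θ n) r + β m * imageCoeff β θ (n + θ m) r +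
        lam * imageCoeff β θ (m + n) r := by
  have h1 := congrArg (fun q => coeff q r) (h m n)
  simpa only [coeff_add, coeff_C_mul_X_pow, imageCoeff, mul_ite, mul_zero, eq_comm (a := r)]
    using h1

variable [IsDomain R]

theorem exponent_zero (hlam : lam ≠ 0) (hconv : ∀ n, β n = 0 → θ n = 0)
    (hR : ∀ m n r, (if θ m + θ n = r then β m * β n else 0) =
      β n * imageCoeff β θ (m + θ n) r + β m * imageCoeff β θ (n + θ m) r +
        lam * imageCoeff β θ (m + n) r) :
    θ 0 = 0 ∧ (β 0 = 0 ∨ β 0 = -lam) := by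
  by_cases h0 : β 0 = 0
  · exact ⟨hconv 0 h0, Or.inl h0⟩
  have hθ : θ 0 = 0 := by
    by_contra ht
    have h1 := hR 0 0 (θ 0 + θ 0)
    have h2 := hR 0 0 (θ 0)
    rw [if_pos rfl, zero_add, zero_add, imageCoeff_of_ne (n := 0) (by omega)] at h1
    rw [if_neg (by omega), zero_add, zero_add, imageCoeff_self (n := 0)] at h2
    by_cases h3 : θ (θ 0) = θ 0
    · rw [imageCoeff_of_ne (by omega)] at h1
      exact mul_ne_zero h0 h0 (by linear_combination h1)
    · rw [imageCoeff_of_ne h3] at h2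
      exact mul_ne_zero hlam h0 (by linear_combination -h2)
  refine ⟨hθ, Or.inr (mul_left_cancel₀ h0 ?_)⟩
  have h1 := hR 0 0 0
  simp only [hθ, imageCoeff, add_zero, if_true] at h1
  linear_combination -h1

theorem fixes_positive_powers_of_weight [Algebra ℚ R] (hlam : lam ≠ 0)
    (hR : ∀ m n r, (if θ m + θ n = r then β m * β n else 0) =
      β n * imageCoeff β θ (m + θ n) r + β m * imageCoeff β θ (n + θ m) r +
        lam * imageCoeff β θ (m + n) r)
    (hid : ∀ n, β n ≠ 0 → θ (θ n) = θ n ∧ β (θ n) = -lam)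
    {p : ℕ} (hp : 0 < p) (hθp : θ p = p) (hβp : β p = -lam) {m : ℕ} (hm : 0 < m) :
    θ m = m ∧ β m = -lam := by
  have : CharZero R := algebraRat.charZero R
  have hinj := IsFractionRing.injective R (FractionRing R)
  set φ := algebraMap R (FractionRing R)
  have hl : φ (-lam) ≠ 0 := (map_ne_zero_iff φ hinj).2 (neg_ne_zero.2 hlam)
  have h2 : (2 : FractionRing R) ≠ 0 := by
    rw [← map_ofNat φ 2]
    exact (map_ne_zero_iff φ hinj).2 two_ne_zero
  set e : ℕ → FractionRing R := fun n => φ (β n) / φ (-lam) with he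
  have he1 : ∀ n, e n = 1 ↔ β n = -lam := fun n => by
    rw [he, div_eq_one_iff_eq hl, hinj.eq_iff]
  have hcoeff : ∀ n r, imageCoeff e θ n r = φ (imageCoeff β θ n r) / φ (-lam) := by
    intro n r
    unfold imageCoeff
    split_ifs <;> simp [he]
  have H : ∀ m n r, (if θ m + θ n = r then e m * e n else 0) =
      e n * imageCoeff e θ (m + θ n) r + e m * imageCoeff e θ (n + θ m) r -
        imageCoeff e θ (m + n) r := by
    intro m n r
    have h1 : (if θ m + θ n = r then e m * e n else 0) =
        φ (if θ m + θ n = r then β m * β n else 0) / φ (-lam) ^ 2 := by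
      split_ifs
      · simp only [he, map_mul]
        field_simp
      · simp
    rw [h1, hR, hcoeff, hcoeff, hcoeff]
    simp only [he, map_add, map_mul]
    have h3 : φ lam = -φ (-lam) := by rw [map_neg, neg_neg]
    rw [h3]
    field_simp
    ring
  have hide : ∀ n, e n ≠ 0 → θ (θ n) = θ n ∧ e (θ n) = 1 := by
    intro n hn
    rw [he1]
    exact hid n fun h0 => hn (by simp [he, h0])
  have h4 := fixes_positive_powers h2 H hide hp hθp ((he1 p).2 hβp) hm
  exact ⟨h4.1, (he1 m).1 h4.2⟩

end Domain

/-- Theorem 3.5: classification of nonzero monomial Rota-Baxter operators of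
nonzero weight `λ` on `R[x]`: they come in exactly four forms. -/
theorem monomial_rota_baxter_nonzero_weight_classification
    {R : Type*} [CommRing R] [IsDomain R] [Algebra ℚ R]
    (lam : R) (hlam : lam ≠ 0)
    (β : ℕ → R) (θ : ℕ → ℕ) (hconv : ∀ n, β n = 0 → θ n = 0)
    (P : Polynomial R →ₗ[R] Polynomial R)
    (hP : ∀ n : ℕ, P (X ^ n) = C (β n) * X ^ (θ n))
    (hnz : ∃ n : ℕ, β n ≠ 0) :
    (∀ f g : Polynomial R,
      P f * P g = P (f * P g) + P (P f * g) + lam • P (f * g)) ↔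
      ((∃ b : R, b ≠ 0 ∧ ∀ n : ℕ, θ n = 0 ∧ (-lam) ^ n * β n = (-lam) * b ^ n) ∨
       (∀ n : ℕ, θ n = n ∧ β n = -lam) ∨
       (θ 0 = 0 ∧ β 0 = 0 ∧ ∀ n : ℕ, 0 < n → θ n = n ∧ β n = -lam) ∨
       ((∀ n : ℕ, θ n = 0) ∧ β 0 = -lam ∧ ∀ n : ℕ, 0 < n → β n = 0)) := by
  rw [rotaBaxter_iff_monomials lam β θ P hP]
  constructor
  · intro h
    have hR := coeff_identity h
    have hz := exponent_zero hlam hconv hR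
    have hid : ∀ n, β n ≠ 0 → θ (θ n) = θ n ∧ β (θ n) = -lam := by
      intro n hn
      have h1 := hR 0 n (θ n)
      rw [hz.1, zero_add, zero_add, add_zero, if_pos rfl, imageCoeff_of_eq (n := n) rfl] at h1
      have h2 : imageCoeff β θ (θ n) (θ n) = -lam :=
        mul_left_cancel₀ hn (by linear_combination -h1)
      unfold imageCoeff at h2
      split_ifs at h2 with h3
      · exact ⟨h3, h2⟩
      · exact absurd h2.symm (neg_ne_zero.2 hlam)
    by_cases hp : ∃ p, 0 < p ∧ θ p = p ∧ β p = -lam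
    · obtain ⟨p, hp, hθp, hβp⟩ := hp
      have hall : ∀ n, 0 < n → θ n = n ∧ β n = -lam := fun n hn =>
        fixes_positive_powers_of_weight hlam hR hid hp hθp hβp hn
      rcases hz with ⟨hθ0, hβ0 | hβ0⟩
      · exact Or.inr (Or.inr (Or.inl ⟨hθ0, hβ0, hall⟩))
      · refine Or.inr (Or.inl fun n => ?_)
        rcases Nat.eq_zero_or_pos n with rfl | hn
        · exact ⟨hθ0, hβ0⟩
        · exact hall n hn
    · have hθ : ∀ n, θ n = 0 := by
        intro n
        by_contra hn
        have hβn : β n ≠ 0 := fun h0 => hn (hconv n h0)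
        exact hp ⟨θ n, Nat.pos_of_ne_zero hn, hid n hβn⟩
      have hβ0 : β 0 = -lam := by
        obtain ⟨n, hn⟩ := hnz
        simpa [hθ n] using (hid n hn).2
      have hmul : ∀ n, -lam * β (n + 1) = β n * β 1 := by
        intro n
        have h1 := hR n 1 0
        simp only [hθ, imageCoeff, add_zero, if_true] at h1
        linear_combination h1
      by_cases hb : β 1 = 0
      · refine Or.inr (Or.inr (Or.inr ⟨hθ, hβ0, fun n hn => ?_⟩))
        obtain ⟨n, rfl⟩ := Nat.exists_eq_add_of_lt hn
        have h1 := hmul n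
        rw [hb, mul_zero] at h1
        simpa [hlam] using h1
      · refine Or.inl ⟨β 1, hb, fun n => ⟨hθ n, ?_⟩⟩
        induction n with
        | zero => simpa using hβ0
        | succ n ih => linear_combination (-lam) ^ n * hmul n + β 1 * ih
  · rintro (⟨b, -, h⟩ | h | ⟨hθ0, hβ0, h⟩ | ⟨hθ, hβ0, h⟩) m n
    · have h1 : -lam * β (m + n) = β m * β n := by
        apply mul_left_cancel₀ (pow_ne_zero (m + n) (neg_ne_zero.2 hlam))
        linear_combination (-lam) * (h (m + n)).2 - (-lam) ^ n * β n * (h m).2 -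
          (-lam) * b ^ m * (h n).2
      simp only [(h _).1, add_zero, pow_zero, mul_one, ← C_add]
      congr 1
      linear_combination h1
    · simp only [(h _).1, (h _).2, add_comm n m, ← add_mul, ← C_add]
      congr 2
      ring
    · rcases Nat.eq_zero_or_pos m with rfl | hm <;> rcases Nat.eq_zero_or_pos n with rfl | hn
      · simp [hβ0]
      · simp [hβ0, h n hn]
      · simp [hβ0, h m hm]
      · simp only [h m hm, h n hn, h (m + n) (by omega), add_comm n m, ← add_mul, ← C_add]
        congr 2
        ring
    · simp only [hθ, add_zero, pow_zero, mul_one, ← C_add]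
      congr 1
      rcases Nat.eq_zero_or_pos m with rfl | hm <;> rcases Nat.eq_zero_or_pos n with rfl | hn
      · rw [hβ0]; ring
      · rw [zero_add, hβ0, h n hn]; ring
      · rw [add_zero, hβ0, h m hm]; ring
      · rw [h m hm, h n hn, h (m + n) (by omega)]; ring
end

section
/- Let c be a positive integer and b ∈ k. The k-linear map P : k[x] → k[x] defined on monomials by P(x^n) = (1/(n+c))·b·x^{n+c} for all n ∈ ℕ (where 1/(n+c) ∈ ℚ acts on k via the inclusion ℚ ⊆ k) is a Rota-Baxter operator of weight 0 on k[x]. In particular, taking b = c = 1, the standard integration operator P(x^n) = x^{n+1}/(n+1) is a Rota-Baxter operator of weight 0. -/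
open Polynomial

/-- The weight-zero Rota-Baxter identity on `R[X]` need only be checked on powers of `X`. -/
theorem Polynomial.rotaBaxter_zero_of_X_pow {R : Type*} [CommRing R] (P : R[X] →ₗ[R] R[X])
    (h : ∀ m n : ℕ, P (X ^ m) * P (X ^ n) = P (X ^ m * P (X ^ n)) + P (P (X ^ m) * X ^ n))
    (f g : R[X]) : P f * P g = P (f * P g) + P (P f * g) := by
  induction f using Polynomial.induction_on' with
  | add p q hp hq =>
    simp only [map_add, add_mul, hp, hq]
    abel
  | monomial m r =>
    induction g using Polynomial.induction_on' with
    | add p q hp hq =>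
      simp only [map_add, mul_add, hp, hq]
      abel
    | monomial n s =>
      simp only [← smul_X_eq_monomial, map_smul, smul_mul_assoc, mul_smul_comm, h, smul_add]

/-- Example 2.10(3): the scaled integration operator
`P(x^n) = (b/(n+c))·x^{n+c}` is a Rota-Baxter operator of weight `0` on `R[x]`;
in particular (taking `b = c = 1`) the standard integration operator
`P(x^n) = x^{n+1}/(n+1)` is a Rota-Baxter operator of weight `0`. -/
theorem scaled_integration_is_rota_baxter_weight_zero
    {R : Type*} [CommRing R] [IsDomain R] [Algebra ℚ R]
    (c : ℕ) (hc : 0 < c) (b : R)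
    (P : Polynomial R →ₗ[R] Polynomial R)
    (hP : ∀ n : ℕ, P (X ^ n) = (((n + c : ℕ) : ℚ)⁻¹) • (C b * X ^ (n + c))) :
    ∀ f g : Polynomial R, P f * P g = P (f * P g) + P (P f * g) := by
  refine rotaBaxter_zero_of_X_pow P fun m n => ?_
  have hP' (n : ℕ) : P (X ^ n) = (algebraMap ℚ R ((n + c : ℕ) : ℚ)⁻¹ * b) • X ^ (n + c) := by
    rw [hP, mul_smul, algebraMap_smul, ← smul_eq_C_mul]
  have key : (((m + c : ℕ) : ℚ)⁻¹) * ((n + c : ℕ) : ℚ)⁻¹ =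
      (((n + c : ℕ) : ℚ)⁻¹ + ((m + c : ℕ) : ℚ)⁻¹) * ((m + n + c + c : ℕ) : ℚ)⁻¹ := by
    have hc' : (0 : ℚ) < c := by exact_mod_cast hc
    push_cast
    field_simp
    ring
  have key' := congrArg (algebraMap ℚ R) key
  simp only [map_mul, map_add] at key'
  rw [hP' m, hP' n]
  simp only [smul_mul_assoc, mul_smul_comm, map_smul, ← pow_add]
  rw [show m + (n + c) = m + n + c by ring, show m + c + n = m + n + c by ring, hP',
    show m + c + (n + c) = m + n + c + c by ring]
  simp only [smul_smul, ← add_smul]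
  congr 1
  linear_combination b ^ 2 * key'
end
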